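/- arXiv:1601.01850 — 2 statements merged into one kernel-verified Lean document; each statement's English description precedes it below -/
import Mathlib

section
/- Let X be a nonempty compact topological space, let n ≥ 1, and for each j ∈ {1,…,n} let ψ_j(x,t) = g_j(x)·t^{γ_j}, where g_j : X → ℝ is continuous and γ_j is a positive integer. Assume that for each x ∈ X the functions t ↦ ψ₁(x,t), …, t ↦ ψ_n(x,t) (from [0,+∞) to ℝ) are linearly independent over ℚ. Then the map ψ = (ψ₁,…,ψ_n) : X × [0,+∞) → ℝ^n is c.u.d. mod 1 on X. -/
open MeasureTheory Filter Set

/-- A box in `[0,1)^n`: a product of intervals contained in `[0,1)`, each with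
nonempty interior. -/
def IsBox {n : ℕ} (I : Set (Fin n → ℝ)) : Prop :=
  ∃ J : Fin n → Set ℝ,
    (∀ i, J i ⊆ Set.Ico (0 : ℝ) 1) ∧
    (∀ i, (J i).OrdConnected) ∧
    (∀ i, (interior (J i)).Nonempty) ∧
    I = Set.univ.pi J

/-- `ψ : X × [0,∞) → ℝ^n` is continuously uniformly distributed modulo 1 on `X`:
for every box `I ⊆ [0,1)^n`, `vol₁({t ∈ [0,T] : {ψ(x,t)} ∈ I}) / T → vol_n(I)`
as `T → +∞`, uniformly in `x ∈ X`. -/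
def IsCudModOneOn {X : Type*} {n : ℕ} (ψ : X → ℝ → Fin n → ℝ) : Prop :=
  ∀ I : Set (Fin n → ℝ), IsBox I →
    TendstoUniformly
      (fun (T : ℝ) (x : X) =>
        (volume {t : ℝ | t ∈ Set.Icc (0 : ℝ) T ∧ (fun i => Int.fract (ψ x t i)) ∈ I}).toReal / T)
      (fun _ => (volume I).toReal) atTop


lemma osc_bound (q R R' : ℝ → ℝ) (hq : ∀ s, HasDerivAt q (R s) s)
    (hR : ∀ s, HasDerivAt R (R' s) s) (hR' : Continuous R') (M η B : ℝ) (hM : 0 < M)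
    (hη : 0 < η) (hB : ∀ s ∈ Icc (0:ℝ) 1, |R' s| ≤ B) :
    ‖∫ s in (0:ℝ)..1, Complex.exp (Complex.I * ((M * q s : ℝ) : ℂ))‖ ≤
      (∫ s in (0:ℝ)..1, η^2 / ((R s)^2 + η^2)) + (1/M) * (1/η + B/η^2) := by
  have hqc : Continuous q := continuous_iff_continuousAt.2 fun s => (hq s).continuousAt
  have hRc : Continuous R := continuous_iff_continuousAt.2 fun s => (hR s).continuousAt
  have hpos : ∀ s, 0 < (R s)^2 + η^2 := fun s => by positivity
  set e : ℝ → ℂ := fun s => Complex.exp (Complex.I * ((M * q s : ℝ) : ℂ)) with he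
  have hec : Continuous e := by fun_prop
  have hen : ∀ s, ‖e s‖ = 1 := fun s => by
    simp only [he]; rw [mul_comm]; exact Complex.norm_exp_ofReal_mul_I _
  set G : ℝ → ℝ := fun s => R s / ((R s)^2 + η^2) with hG
  set G' : ℝ → ℝ := fun s => R' s * (η^2 - (R s)^2) / ((R s)^2 + η^2)^2 with hG'
  have hGc : Continuous G := hRc.div (by fun_prop) fun s => (hpos s).ne'
  have hG'c : Continuous G' := Continuous.div (by fun_prop) (by fun_prop)
    fun s => (pow_pos (hpos s) 2).ne'
  have hGd : ∀ s, HasDerivAt G (G' s) s := fun s => by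
    have h := (hR s).div (((hR s).pow 2).add_const (η^2)) (hpos s).ne'
    refine h.congr_deriv ?_
    simp only [hG', Pi.pow_apply]; congr 1; push_cast; ring
  have hed : ∀ s, HasDerivAt e (e s * (Complex.I * ((M * R s : ℝ) : ℂ))) s := fun s => by
    exact ((((hq s).const_mul M).ofReal_comp).const_mul Complex.I).cexp
  set K : ℝ → ℝ := fun s => η^2 / ((R s)^2 + η^2) with hK
  have hKc : Continuous K := continuous_const.div (by fun_prop) fun s => (hpos s).ne'
  have hFd : ∀ s, HasDerivAt (fun s => e s * (G s : ℂ))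
      (e s * (Complex.I * ((M * R s : ℝ) : ℂ)) * (G s : ℂ) + e s * (G' s : ℂ)) s := fun s =>
    (hed s).mul (hGd s).ofReal_comp
  have hFc : Continuous fun s =>
      (e s * (Complex.I * ((M * R s : ℝ) : ℂ)) * (G s : ℂ) + e s * (G' s : ℂ)) := by fun_prop
  have hfint := intervalIntegral.integral_eq_sub_of_hasDerivAt (a := 0) (b := 1)
    (fun s _ => hFd s) (hFc.intervalIntegrable _ _)
  have hdec : ∀ s, e s = e s * (K s : ℂ) + (1 / (Complex.I * M)) *
      ((e s * (Complex.I * ((M * R s : ℝ) : ℂ)) * (G s : ℂ) + e s * (G' s : ℂ))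
        - e s * (G' s : ℂ)) := fun s => by
    have h1 : K s + R s * G s = 1 := by
      simp only [hK, hG]; field_simp [(hpos s).ne']; ring
    have h2 : (K s : ℂ) + R s * G s = 1 := by exact_mod_cast h1
    have hM' : (M : ℂ) ≠ 0 := by exact_mod_cast hM.ne'
    have hI := Complex.I_ne_zero
    push_cast
    field_simp
    linear_combination (- (Complex.I * M) * e s) * h2
  have hGb : ∀ s, |G s| ≤ 1 / (2 * η) := fun s => by
    simp only [hG]
    rw [abs_div, abs_of_pos (hpos s), div_le_div_iff₀ (hpos s) (by positivity)]
    nlinarith [sq_nonneg (|R s| - η), sq_abs (R s)]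
  have hG'b : ∀ s ∈ Icc (0:ℝ) 1, |G' s| ≤ B / η^2 := fun s hs => by
    have hb := hB s hs
    have hB0 : 0 ≤ B := (abs_nonneg _).trans hb
    simp only [hG']
    rw [abs_div, abs_mul, abs_of_pos (pow_pos (hpos s) 2)]
    have h3 : |η^2 - (R s)^2| ≤ (R s)^2 + η^2 := by
      rw [abs_le]; constructor <;> nlinarith [sq_nonneg (R s), sq_nonneg η]
    rw [div_le_div_iff₀ (pow_pos (hpos s) 2) (by positivity)]
    have h4 : |R' s| * |η^2 - (R s)^2| ≤ B * ((R s)^2 + η^2) :=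
      mul_le_mul hb h3 (abs_nonneg _) hB0
    calc _ ≤ B * ((R s)^2 + η^2) * η^2 := by gcongr
      _ ≤ B * ((R s)^2 + η^2) * ((R s)^2 + η^2) := by
        gcongr; nlinarith [sq_nonneg (R s)]
      _ = _ := by ring
  have hI1 : ‖∫ s in (0:ℝ)..1, e s * (K s : ℂ)‖ ≤ ∫ s in (0:ℝ)..1, K s := by
    refine (intervalIntegral.norm_integral_le_integral_norm zero_le_one).trans_eq ?_
    refine intervalIntegral.integral_congr fun s _ => ?_
    have : 0 ≤ K s := by simp only [hK]; have := hpos s; positivity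
    simp [hen, abs_of_nonneg this]
  have hI2 : ‖∫ s in (0:ℝ)..1, e s * (G' s : ℂ)‖ ≤ B / η^2 := by
    have := intervalIntegral.norm_integral_le_of_norm_le_const (a := 0) (b := 1)
      (f := fun s => e s * (G' s : ℂ)) (C := B / η^2) (fun s hs => by
        rw [uIoc_of_le zero_le_one] at hs
        simpa [hen] using hG'b s ⟨hs.1.le, hs.2⟩)
    simpa using this
  have hI3 : ‖e 1 * (G 1 : ℂ) - e 0 * (G 0 : ℂ)‖ ≤ 1 / η := by
    refine (norm_sub_le _ _).trans ?_
    have h1 := hGb 1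
    have h0 := hGb 0
    have : 1 / η = 1 / (2 * η) + 1 / (2 * η) := by field_simp; norm_num
    rw [this]
    simp only [norm_mul, hen, one_mul, Complex.norm_real, Real.norm_eq_abs]
    linarith
  have hsplit : ∫ s in (0:ℝ)..1, e s = (∫ s in (0:ℝ)..1, e s * (K s : ℂ)) +
      (1 / (Complex.I * M)) * ((e 1 * (G 1 : ℂ) - e 0 * (G 0 : ℂ))
        - ∫ s in (0:ℝ)..1, e s * (G' s : ℂ)) := by
    rw [← hfint, ← intervalIntegral.integral_sub, ← intervalIntegral.integral_const_mul,
      ← intervalIntegral.integral_add]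
    · exact intervalIntegral.integral_congr fun s _ => hdec s
    all_goals apply Continuous.intervalIntegrable; fun_prop
  rw [hsplit]
  refine (norm_add_le _ _).trans (add_le_add hI1 ?_)
  rw [norm_mul]
  have : ‖1 / (Complex.I * (M:ℂ))‖ = 1 / M := by simp [abs_of_pos hM]
  rw [this]
  gcongr
  exact (norm_sub_le _ _).trans (add_le_add hI3 hI2)

noncomputable def Rp (d : ℕ) (r : Fin d → ℝ) (s : ℝ) : ℝ := ∑ k, r k * (((k:ℕ) + 1) * s ^ (k:ℕ))

lemma Rp_cont (d : ℕ) : Continuous fun p : (Fin d → ℝ) × ℝ => Rp d p.1 p.2 := by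
  unfold Rp; fun_prop

lemma Rp_ae (d : ℕ) (r : Fin d → ℝ) (hr : r ≠ 0) : ∀ᵐ s : ℝ, Rp d r s ≠ 0 := by
  set P : Polynomial ℝ := ∑ k : Fin d, Polynomial.C (r k * ((k:ℕ) + 1)) * Polynomial.X ^ (k:ℕ)
    with hP
  have hP0 : P ≠ 0 := by
    intro h
    apply hr
    funext k
    have h1 : P.coeff k = 0 := by rw [h]; simp
    rw [hP, Polynomial.finsetSum_coeff] at h1
    simp only [Polynomial.coeff_C_mul_X_pow] at h1
    rw [Finset.sum_eq_single k] at h1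
    · simp only [if_true] at h1
      have : ((k:ℕ):ℝ) + 1 ≠ 0 := by positivity
      simpa [this] using h1
    · intro b _ hb
      rw [if_neg]; intro h; exact hb (Fin.ext h.symm)
    · simp
  have hev : ∀ s, P.eval s = Rp d r s := fun s => by
    simp [hP, Rp, Polynomial.eval_finsetSum, mul_assoc]
  have hfin : {s : ℝ | Rp d r s = 0}.Finite := by
    refine (P.roots.toFinset.finite_toSet).subset fun s hs => ?_
    simp [hP0, hev]; exact hs
  have := hfin.measure_zero volume
  rw [ae_iff]; simpa using this

lemma unif_small (d : ℕ) (ε : ℝ) (hε : 0 < ε) : ∃ η > 0, ∀ r : Fin d → ℝ, ‖r‖ = 1 →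
    ∫ s in (0:ℝ)..1, η^2 / ((Rp d r s)^2 + η^2) ≤ ε := by
  have hc : ∀ η : ℝ, 0 < η → Continuous fun p : (Fin d → ℝ) × ℝ => η^2 / ((Rp d p.1 p.2)^2 + η^2) :=
    fun η hη => continuous_const.div (((Rp_cont d).pow 2).add continuous_const)
      fun p => by positivity
  have hcs : ∀ (r : Fin d → ℝ) (η : ℝ), 0 < η → Continuous fun s => η^2 / ((Rp d r s)^2 + η^2) :=
    fun r η hη => (hc η hη).comp (f := fun s => (r, s)) (by fun_prop)
  have key : ∃ η > 0, ∀ r ∈ Metric.sphere (0 : Fin d → ℝ) 1,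
    ∫ s in (0:ℝ)..1, η^2 / ((Rp d r s)^2 + η^2) ≤ ε := by
    refine (isCompact_sphere (0 : Fin d → ℝ) 1).induction_on
      (p := fun S => ∃ η > 0, ∀ r ∈ S, ∫ s in (0:ℝ)..1, η^2 / ((Rp d r s)^2 + η^2) ≤ ε)
      ⟨1, one_pos, by simp⟩ ?_ ?_ ?_
    · rintro s t hst ⟨η, h, h'⟩
      exact ⟨η, h, fun r hr => h' r (hst hr)⟩
    · rintro s t ⟨η, h, h'⟩ ⟨θ, k, k'⟩
      have mono : ∀ (r : Fin d → ℝ) (a b : ℝ), 0 < a → 0 < b → a ≤ b →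
          ∫ s in (0:ℝ)..1, a^2 / ((Rp d r s)^2 + a^2) ≤
          ∫ s in (0:ℝ)..1, b^2 / ((Rp d r s)^2 + b^2) := by
        intro r a b ha hb hab
        refine intervalIntegral.integral_mono_on zero_le_one
          ((hcs r a ha).intervalIntegrable _ _) ((hcs r b hb).intervalIntegrable _ _) fun s _ => ?_
        rw [div_le_div_iff₀ (by positivity) (by positivity)]
        have : a^2 ≤ b^2 := by gcongr
        nlinarith [mul_le_mul_of_nonneg_right this (sq_nonneg (Rp d r s))]
      refine ⟨min η θ, lt_min h k, ?_⟩
      rintro r (hr | hr)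
      · exact (mono r _ _ (lt_min h k) h (min_le_left _ _)).trans (h' r hr)
      · exact (mono r _ _ (lt_min h k) k (min_le_right _ _)).trans (k' r hr)
    · intro r hr
      have hr0 : r ≠ 0 := by
        rintro rfl; simp at hr
      have hlim : Tendsto (fun η : ℝ => ∫ s in (0:ℝ)..1, η^2 / ((Rp d r s)^2 + η^2))
          (nhdsWithin 0 (Ioi 0)) (nhds (∫ s in (0:ℝ)..1, (0:ℝ))) := by
        apply intervalIntegral.tendsto_integral_filter_of_dominated_convergence (fun _ => (1:ℝ))
        · filter_upwards [self_mem_nhdsWithin] with η hη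
          exact (hcs r η hη).aestronglyMeasurable
        · filter_upwards [self_mem_nhdsWithin] with η hη
          refine Eventually.of_forall fun s _ => ?_
          have : (0:ℝ) < η := hη
          rw [Real.norm_of_nonneg (by positivity), div_le_one (by positivity)]
          nlinarith [sq_nonneg (Rp d r s)]
        · simp
        · filter_upwards [Rp_ae d r hr0] with s hs _
          have : ContinuousAt (fun η : ℝ => η^2 / ((Rp d r s)^2 + η^2)) 0 := by
            apply ContinuousAt.div <;> first | fun_prop | simpa using hs
          have h := this.tendsto
          simp only [ne_eq, OfNat.ofNat_ne_zero, not_false_eq_true, zero_pow, zero_div] at h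
          exact h.mono_left nhdsWithin_le_nhds
      rw [intervalIntegral.integral_zero] at hlim
      obtain ⟨η, hη1, hη⟩ := ((hlim.eventually (gt_mem_nhds hε)).and self_mem_nhdsWithin).exists
      have hη : 0 < η := hη
      have hcont : Continuous fun r => ∫ s in (0:ℝ)..1, η^2 / ((Rp d r s)^2 + η^2) :=
        intervalIntegral.continuous_parametric_intervalIntegral_of_continuous' (hc η hη) 0 1
      refine ⟨{r | ∫ s in (0:ℝ)..1, η^2 / ((Rp d r s)^2 + η^2) < ε}, ?_, η, hη, fun r hr => le_of_lt hr⟩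
      exact mem_nhdsWithin_of_mem_nhds (hcont.continuousAt.eventually (gt_mem_nhds hη1))
  obtain ⟨η, h, h'⟩ := key
  exact ⟨η, h, fun r hr => h' r (by simpa using hr)⟩

lemma osc_unif (d : ℕ) (ε : ℝ) (hε : 0 < ε) : ∃ M > 0, ∀ c : Fin d → ℝ, M ≤ ‖c‖ →
    ‖∫ s in (0:ℝ)..1, Complex.exp (Complex.I * ((∑ k, c k * s ^ ((k:ℕ)+1) : ℝ) : ℂ))‖ ≤ ε := by
  obtain ⟨η, hη, hu⟩ := unif_small d (ε/2) (by positivity)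
  set B : ℝ := ∑ k : Fin d, (((k:ℕ):ℝ) + 1) * (k:ℕ) with hB
  have hB0 : 0 ≤ B := Finset.sum_nonneg fun _ _ => by positivity
  set C : ℝ := 1/η + B/η^2 with hC
  have hC0 : 0 < C := by positivity
  refine ⟨2 * C / ε, by positivity, fun c hc => ?_⟩
  have hM : 0 < ‖c‖ := lt_of_lt_of_le (by positivity) hc
  set M := ‖c‖
  set r : Fin d → ℝ := M⁻¹ • c with hr
  have hrn : ‖r‖ = 1 := by
    rw [hr, norm_smul, Real.norm_of_nonneg (by positivity)]; exact inv_mul_cancel₀ hM.ne'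
  have h := osc_bound (fun s => ∑ k, r k * s ^ ((k:ℕ)+1)) (Rp d r)
    (fun s => ∑ k : Fin d, r k * (((k:ℕ) + 1) * ((k:ℕ) * s ^ ((k:ℕ)-1))))
    (fun s => by
      unfold Rp
      refine HasDerivAt.fun_sum fun k _ => ?_
      simpa using (hasDerivAt_pow ((k:ℕ)+1) s).const_mul (r k))
    (fun s => by
      unfold Rp
      refine HasDerivAt.fun_sum fun k _ => ?_
      exact ((hasDerivAt_pow (k:ℕ) s).const_mul _).const_mul (r k))
    (by fun_prop) M η B hM hη (fun s hs => by
      refine (Finset.abs_sum_le_sum_abs _ _).trans (Finset.sum_le_sum fun k _ => ?_)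
      have h1 : |r k| ≤ 1 := by rw [← hrn]; exact norm_le_pi_norm r k
      have h2 : s ^ ((k:ℕ)-1) ≤ 1 := pow_le_one₀ hs.1 hs.2
      have h3 : 0 ≤ s ^ ((k:ℕ)-1) := pow_nonneg hs.1 _
      rw [abs_mul, abs_of_nonneg (a := _ * _) (by positivity)]
      calc _ ≤ 1 * ((((k:ℕ):ℝ) + 1) * ((k:ℕ) * 1)) := by gcongr
        _ = _ := by ring)
  have hcr : ∀ k, c k = M * r k := fun k => by simp [hr, mul_inv_cancel_left₀ hM.ne']
  have heq : ∀ s : ℝ, ∑ k, c k * s ^ ((k:ℕ)+1) = M * ∑ k, r k * s ^ ((k:ℕ)+1) := fun s => by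
    rw [Finset.mul_sum]; exact Finset.sum_congr rfl fun k _ => by rw [hcr]; ring
  simp_rw [heq]
  refine h.trans ?_
  have h5 := hu r hrn
  have h6 : 1 / M * C ≤ ε / 2 := by
    rw [div_le_iff₀ hε] at hc
    rw [one_div, inv_mul_le_iff₀ hM]; linarith
  linarith

instance : IsProbabilityMeasure (volume : Measure UnitAddCircle) := ⟨by simp⟩
open Topology
lemma int_four {n : ℕ} (h : Fin n → ℤ) (hh : h ≠ 0) :
    ∫ y : UnitAddTorus (Fin n), UnitAddTorus.mFourier h y = 0 := by
  simp only [UnitAddTorus.mFourier, ContinuousMap.coe_mk]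
  obtain ⟨i, hi⟩ := Function.ne_iff.1 hh
  have h1 := integral_fintype_prod_volume_eq_prod (𝕜 := ℂ) (ι := Fin n) (E := fun _ => UnitAddCircle)
    (fun i x => fourier (h i) x)
  refine h1.trans (Finset.prod_eq_zero (Finset.mem_univ i) ?_)
  exact integral_eq_zero_of_add_right_eq_neg (fourier_add_half_inv_index hi one_pos)

noncomputable def volP (n : ℕ) : ProbabilityMeasure (UnitAddTorus (Fin n)) :=
  ⟨volume, inferInstance⟩

lemma weyl {ι : Type*} {L : Filter ι} {n : ℕ} (μs : ι → ProbabilityMeasure (UnitAddTorus (Fin n)))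
    (hμ : ∀ h : Fin n → ℤ, h ≠ 0 →
      Tendsto (fun i => ∫ y, UnitAddTorus.mFourier h y ∂(μs i : Measure _)) L (𝓝 0)) :
    Tendsto μs L (𝓝 (volP n)) := by
  rw [ProbabilityMeasure.tendsto_iff_forall_integral_rclike_tendsto ℂ]
  have hfint : ∀ (μ : Measure (UnitAddTorus (Fin n))) [IsProbabilityMeasure μ]
    (f : C(UnitAddTorus (Fin n), ℂ)), Integrable f μ := fun μ _ f =>
      f.continuous.integrable_of_hasCompactSupport (HasCompactSupport.of_compactSpace _)
  have hspan : ∀ f ∈ Submodule.span ℂ (range (UnitAddTorus.mFourier (d := Fin n))),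
      Tendsto (fun i => ∫ y, f y ∂(μs i : Measure _)) L (𝓝 (∫ y, f y)) := by
    intro f hf
    induction hf using Submodule.span_induction with
    | mem f hf =>
      obtain ⟨h, rfl⟩ := hf
      by_cases hh : h = 0
      · subst hh; simpa [UnitAddTorus.mFourier_zero] using tendsto_const_nhds
      · rw [int_four h hh]; exact hμ h hh
    | zero => simpa using tendsto_const_nhds
    | add f g _ _ hf hg =>
      simp only [ContinuousMap.add_apply]
      simp_rw [integral_add (hfint _ f) (hfint _ g)]
      exact hf.add hg
    | smul c f _ hf =>
      simp only [ContinuousMap.smul_apply, integral_smul]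
      exact hf.const_smul c
  intro f
  rw [Metric.tendsto_nhds]
  intro ε hε
  have hd : f.toContinuousMap ∈ closure (Submodule.span ℂ (range (UnitAddTorus.mFourier (d := Fin n))) : Set C(UnitAddTorus (Fin n), ℂ)) := by
    rw [← Submodule.topologicalClosure_coe, UnitAddTorus.span_mFourier_closure_eq_top]; trivial
  obtain ⟨p, hp, hfp⟩ := Metric.mem_closure_iff.1 hd (ε/3) (by positivity)
  have hb : ∀ (μ : Measure (UnitAddTorus (Fin n))) [IsProbabilityMeasure μ],
      dist (∫ y, f y ∂μ) (∫ y, p y ∂μ) ≤ ε/3 := by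
    intro μ _
    have h1 := hfint μ f.toContinuousMap
    change dist (∫ y, f.toContinuousMap y ∂μ) _ ≤ _
    rw [dist_eq_norm, ← integral_sub h1 (hfint μ p)]
    refine (norm_integral_le_of_norm_le_const (C := ε/3) (Eventually.of_forall fun y => ?_)).trans_eq (by simp)
    rw [← dist_eq_norm]
    exact (ContinuousMap.dist_apply_le_dist y).trans hfp.le
  filter_upwards [Metric.tendsto_nhds.1 (hspan p hp) (ε/3) (by positivity)] with i hi
  have h1 := hb (μs i)
  have h2 := hb (volume)
  have h3 := dist_triangle4 (∫ y, f y ∂(μs i : Measure _)) (∫ y, p y ∂(μs i : Measure _)) (∫ y, p y) (∫ y, f y)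
  rw [dist_comm] at h2
  change dist _ (∫ y, f y) < ε
  linarith


lemma arc (J : Set ℝ) (hJ : J ⊆ Ico 0 1) (ho : J.OrdConnected) (hne : (interior J).Nonempty) :
    volume (frontier ((fun x : ℝ => (x : UnitAddCircle)) '' J)) = 0 ∧
    volume ((fun x : ℝ => (x : UnitAddCircle)) '' J) = volume J ∧
    MeasurableSet ((fun x : ℝ => (x : UnitAddCircle)) '' J) := by
  have hJne : J.Nonempty := hne.mono interior_subset
  set a := sInf J
  set b := sSup J
  have hbb : BddBelow J := ⟨0, fun x hx => (hJ hx).1⟩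
  have hba : BddAbove J := ⟨1, fun x hx => (hJ hx).2.le⟩
  have h1 : Ioo a b ⊆ J := by
    intro x hx
    obtain ⟨u, hu, hu'⟩ := exists_lt_of_csInf_lt hJne hx.1
    obtain ⟨v, hv, hv'⟩ := exists_lt_of_lt_csSup hJne hx.2
    exact ho.out hu hv ⟨hu'.le, hv'.le⟩
  have h2 : J ⊆ Icc a b := fun x hx => ⟨csInf_le hbb hx, le_csSup hba hx⟩
  set π : ℝ → UnitAddCircle := fun x => (x : UnitAddCircle)
  have hπc : Continuous π := AddCircle.continuous_mk' 1
  have hop : IsOpen (π '' Ioo a b) := QuotientAddGroup.isOpenMap_coe _ isOpen_Ioo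
  have hcl : IsClosed (π '' Icc a b) := (isCompact_Icc.image hπc).isClosed
  have hfr : frontier (π '' J) ⊆ π '' {a, b} := by
    intro y hy
    have hy1 : y ∈ π '' Icc a b := closure_minimal (image_mono h2) hcl hy.1
    obtain ⟨x, hx, rfl⟩ := hy1
    by_cases hxx : x ∈ Ioo a b
    · exact absurd (interior_maximal (image_mono h1) hop ⟨x, hxx, rfl⟩) hy.2
    · refine ⟨x, ?_, rfl⟩
      rcases eq_or_lt_of_le hx.1 with h | h
      · left; exact h.symm
      · rcases eq_or_lt_of_le hx.2 with h' | h'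
        · right; exact h'
        · exact absurd ⟨h, h'⟩ hxx
  have hfin : ((π '' {a, b}).Finite) := (Set.toFinite _)
  have hfr0 : volume (frontier (π '' J)) = 0 := by
    refine measure_mono_null (hfr.trans (b := π '' {a,b}) le_rfl) ?_
    rw [measure_null_iff_singleton hfin.countable]
    intro y _
    have := AddCircle.volume_closedBall (T := 1) (x := y) 0
    simpa using this
  have hmeas : MeasurableSet (π '' J) := by
    have : π '' J = π '' Ioo a b ∪ π '' (J \ Ioo a b) := by
      rw [← image_union, union_sdiff_cancel h1]
    rw [this]
    refine hop.measurableSet.union (Set.Finite.measurableSet ?_)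
    refine hfin.subset (image_mono ?_)
    rintro x ⟨hx, hxx⟩
    rcases eq_or_lt_of_le (h2 hx).1 with h | h
    · left; exact h.symm
    · rcases eq_or_lt_of_le (h2 hx).2 with h' | h'
      · right; exact h'
      · exact absurd ⟨h, h'⟩ hxx
  refine ⟨hfr0, ?_, hmeas⟩
  have hnull : NullMeasurableSet (π '' J) volume := hmeas.nullMeasurableSet
  have hmp := UnitAddCircle.measurePreserving_mk 0
  rw [← hmp.measure_preimage hnull, Measure.restrict_apply₀ (hnull.preimage hmp.quasiMeasurePreserving)]
  apply measure_congr
  rw [ae_eq_set]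
  have key : ∀ x ∈ Ioo (0:ℝ) 1, π x ∈ π '' J → x ∈ J := by
    rintro x hx ⟨z, hz, hzx⟩
    have : z = x := (AddCircle.coe_eq_coe_iff_of_mem_Ico (p := 1) (a := 0) (by simpa using hJ hz) (by simpa using ⟨hx.1.le, hx.2⟩)).1 hzx
    exact this ▸ hz
  constructor
  · refine measure_mono_null (t := {1}) ?_ (by simp)
    rintro x ⟨⟨hx, hx1⟩, hx2⟩
    by_contra hne
    simp at hx1 hne
    exact hx2 (key x ⟨hx1.1, lt_of_le_of_ne hx1.2 hne⟩ hx)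
  · refine measure_mono_null (t := {0}) ?_ (by simp)
    rintro x ⟨hx, hx2⟩
    by_contra hne
    apply hx2
    have := hJ hx
    refine ⟨⟨x, hx, rfl⟩, lt_of_le_of_ne this.1 (Ne.symm hne), by linarith [this.2]⟩

lemma box {n : ℕ} (J : Fin n → Set ℝ) (hJ : ∀ i, J i ⊆ Ico 0 1) (ho : ∀ i, (J i).OrdConnected)
    (hne : ∀ i, (interior (J i)).Nonempty) :
    (volume : Measure (UnitAddTorus (Fin n))) (frontier (univ.pi fun i => (fun x : ℝ => (x : UnitAddCircle)) '' J i)) = 0 ∧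
    (volume : Measure (UnitAddTorus (Fin n))) (univ.pi fun i => (fun x : ℝ => (x : UnitAddCircle)) '' J i) = volume (univ.pi J) := by
  constructor
  · refine measure_mono_null (t := ⋃ i, Function.eval i ⁻¹' (frontier ((fun x : ℝ => (x : UnitAddCircle)) '' J i))) ?_ ?_
    · intro y hy
      rw [frontier, closure_pi_set, interior_pi_set finite_univ] at hy
      obtain ⟨hy1, hy2⟩ := hy
      simp only [Set.mem_pi, not_forall] at hy2
      obtain ⟨i, hi, hi2⟩ := hy2
      exact mem_iUnion.2 ⟨i, hy1 i hi, hi2⟩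
    · rw [measure_iUnion_null_iff]
      intro i
      exact (Measure.quasiMeasurePreserving_eval (fun _ : Fin n => (volume : Measure UnitAddCircle)) i).preimage_null
        (arc _ (hJ i) (ho i) (hne i)).1
  · rw [volume_pi_pi]
    erw [volume_pi_pi]
    exact Finset.prod_congr rfl fun i _ => (arc _ (hJ i) (ho i) (hne i)).2.1

lemma regroup {n : ℕ} (γ : Fin n → ℕ) (hγ : ∀ i, 0 < γ i) (a : Fin n → ℝ) (s : ℝ) :
    ∑ k : Fin (∑ i, γ i), (∑ i, if γ i = (k:ℕ) + 1 then a i else 0) * s ^ ((k:ℕ)+1)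
      = ∑ i, a i * s ^ γ i := by
  simp_rw [Finset.sum_mul]
  rw [Finset.sum_comm]
  refine Finset.sum_congr rfl fun i _ => ?_
  have hle : γ i ≤ ∑ i, γ i := Finset.single_le_sum (f := γ) (fun _ _ => Nat.zero_le _)
    (Finset.mem_univ i)
  have hi := hγ i
  rw [Finset.sum_eq_single (⟨γ i - 1, by omega⟩ : Fin (∑ i, γ i))]
  · have : γ i = γ i - 1 + 1 := by omega
    simp only [← this, if_true]
  · intro k _ hk
    rw [if_neg, zero_mul]
    intro h
    apply hk
    apply Fin.ext
    simp; omega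
  · simp

lemma char_tendsto {X : Type*} [TopologicalSpace X] [CompactSpace X] [Nonempty X]
    (n : ℕ) (g : Fin n → X → ℝ) (hg : ∀ i, Continuous (g i))
    (γ : Fin n → ℕ) (hγ : ∀ i, 0 < γ i)
    (hindep : ∀ x : X,
      LinearIndependent ℚ (fun (i : Fin n) => fun (t : ℝ) => g i x * t ^ γ i))
    (h : Fin n → ℤ) (hh : h ≠ 0) :
    Tendsto (fun q : ℝ × X => ∫ s in (0:ℝ)..1, Complex.exp (Complex.I *
      ((∑ i, (2 * Real.pi * h i * g i q.2 * (max q.1 1) ^ γ i) * s ^ γ i : ℝ) : ℂ)))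
      (atTop ×ˢ ⊤) (𝓝 0) := by
  set D := ∑ i, γ i with hD
  set c0 : X → Fin D → ℝ := fun x k =>
    ∑ i, if γ i = (k:ℕ) + 1 then 2 * Real.pi * h i * g i x else 0 with hc0
  have hc0c : Continuous c0 := by
    refine continuous_pi fun k => continuous_finsetSum _ fun i _ => ?_
    split_ifs
    · have := hg i; fun_prop
    · fun_prop
  have hc0n : ∀ x, c0 x ≠ 0 := by
    intro x hx
    have h1 : ∀ s : ℝ, ∑ i, (2 * Real.pi * h i * g i x) * s ^ γ i = 0 := fun s => by
      rw [← regroup γ hγ]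
      refine Finset.sum_eq_zero fun k _ => ?_
      have := congrFun hx k
      simp only [hc0, Pi.zero_apply] at this
      rw [this, zero_mul]
    have h2 := Fintype.linearIndependent_iff.1 (hindep x) (fun i => (h i : ℚ)) (by
      funext s
      have h3 := h1 s
      have h4 : 2 * Real.pi * ∑ i, (h i : ℝ) * (g i x * s ^ γ i) = 0 := by
        rw [← h3, Finset.mul_sum]; exact Finset.sum_congr rfl fun i _ => by ring
      have h5 := (mul_eq_zero.1 h4).resolve_left (by positivity)
      simpa [Finset.sum_apply, Rat.smul_def] using h5)
    apply hh
    funext i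
    exact_mod_cast h2 i
  obtain ⟨x0, -, hx0⟩ := isCompact_univ.exists_isMinOn univ_nonempty
    (hc0c.norm.continuousOn (s := univ))
  set δ := ‖c0 x0‖
  have hδ : 0 < δ := norm_pos_iff.2 (hc0n x0)
  rw [Metric.tendsto_nhds]
  intro ε hε
  obtain ⟨M, hM, hosc⟩ := osc_unif D (ε/2) (by positivity)
  have hev : ∀ᶠ q : ℝ × X in atTop ×ˢ ⊤, M / δ ≤ q.1 ∧ 1 ≤ q.1 :=
    tendsto_fst.eventually ((eventually_ge_atTop _).and (eventually_ge_atTop _))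
  filter_upwards [hev] with q hq
  obtain ⟨hq1, hq2⟩ := hq
  obtain ⟨T, x⟩ := q
  simp only at hq1 hq2 ⊢
  rw [max_eq_left hq2]
  rw [dist_zero_right]
  set c : Fin D → ℝ := fun k =>
    ∑ i, if γ i = (k:ℕ) + 1 then 2 * Real.pi * h i * g i x * T ^ γ i else 0 with hc
  have hck : ∀ k, c k = c0 x k * T ^ ((k:ℕ)+1) := fun k => by
    simp only [hc, hc0, Finset.sum_mul]
    refine Finset.sum_congr rfl fun i _ => ?_
    split_ifs with hi
    · rw [hi]
    · simp
  have hnorm : ‖c0 x‖ ≤ ‖c‖ / T := by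
    rw [pi_norm_le_iff_of_nonneg (by positivity)]
    intro k
    rw [le_div_iff₀ (by positivity)]
    refine le_trans ?_ (norm_le_pi_norm c k)
    rw [hck, norm_mul]
    gcongr
    rw [Real.norm_of_nonneg (by positivity)]
    exact le_self_pow₀ hq2 (by omega)
  have hMc : M ≤ ‖c‖ := by
    have h1 : δ ≤ ‖c‖ / T := (hx0 (mem_univ x)).trans hnorm
    rw [le_div_iff₀ (by positivity)] at h1
    rw [div_le_iff₀ hδ] at hq1
    linarith
  have := hosc c hMc
  have hre : ∀ s : ℝ, ∑ k, c k * s ^ ((k:ℕ)+1) =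
      ∑ i, (2 * Real.pi * h i * g i x * T ^ γ i) * s ^ γ i := fun s =>
    regroup γ hγ (fun i => 2 * Real.pi * h i * g i x * T ^ γ i) s
  simp_rw [hre] at this
  linarith

theorem stmt10 {X : Type*} [TopologicalSpace X] [CompactSpace X] [Nonempty X]
    (n : ℕ) (hn : 1 ≤ n) (g : Fin n → X → ℝ) (hg : ∀ i, Continuous (g i))
    (γ : Fin n → ℕ) (hγ : ∀ i, 0 < γ i)
    (hindep : ∀ x : X,
      LinearIndependent ℚ (fun (i : Fin n) => fun (t : ℝ) => g i x * t ^ γ i)) :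
    IsCudModOneOn (fun (x : X) (t : ℝ) (i : Fin n) => g i x * t ^ γ i) := by
  rintro I ⟨J, hJ, ho, hne, rfl⟩
  set Φ : ℝ × X → ℝ → UnitAddTorus (Fin n) := fun q s i =>
    ((g i q.2 * (max q.1 1 * s) ^ γ i : ℝ) : UnitAddCircle) with hΦ
  have hΦc : ∀ q, Continuous (Φ q) := fun q => by
    refine continuous_pi fun i => ?_
    exact (AddCircle.continuous_mk' 1).comp (by fun_prop)
  have : IsProbabilityMeasure (volume.restrict (Icc (0:ℝ) 1)) := ⟨by simp⟩
  set μs : ℝ × X → ProbabilityMeasure (UnitAddTorus (Fin n)) := fun q =>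
    ⟨(volume.restrict (Icc (0:ℝ) 1)).map (Φ q),
      Measure.isProbabilityMeasure_map (hΦc q).aemeasurable⟩ with hμs
  have hw : Tendsto μs (atTop ×ˢ ⊤) (𝓝 (volP n)) := by
    apply weyl
    intro h hh
    refine (char_tendsto n g hg γ hγ hindep h hh).congr fun q => ?_
    change _ = ∫ y, UnitAddTorus.mFourier h y ∂((volume.restrict (Icc (0:ℝ) 1)).map (Φ q))
    rw [integral_map (hΦc q).aemeasurable
      (UnitAddTorus.mFourier h).continuous.aestronglyMeasurable,
      integral_Icc_eq_integral_Ioc, intervalIntegral.integral_of_le zero_le_one]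
    congr 1
    funext s
    simp only [UnitAddTorus.mFourier, ContinuousMap.coe_mk, hΦ]
    simp_rw [fourier_coe_apply]
    rw [← Complex.exp_sum]
    congr 1
    push_cast
    rw [Finset.mul_sum]
    refine Finset.sum_congr rfl fun i _ => ?_
    rw [mul_pow]
    ring
  obtain ⟨hb1, hb2⟩ := box J hJ ho hne
  set E : Set (UnitAddTorus (Fin n)) :=
    univ.pi fun i => (fun x : ℝ => (x : UnitAddCircle)) '' J i with hE
  have hEm : MeasurableSet E := MeasurableSet.univ_pi fun i => (arc _ (hJ i) (ho i) (hne i)).2.2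
  have hlim := ProbabilityMeasure.tendsto_measure_of_null_frontier_of_tendsto' hw (E := E) hb1
  have hlim2 := (ENNReal.tendsto_toReal (measure_ne_top (volP n : Measure _) E)).comp hlim
  have hvol : ((volP n : Measure (UnitAddTorus (Fin n))) E).toReal
      = (volume (univ.pi J)).toReal := congrArg ENNReal.toReal hb2
  rw [hvol] at hlim2
  rw [Metric.tendstoUniformly_iff]
  intro ε hε
  have h1 := Metric.tendsto_nhds.1 hlim2 ε hε
  rw [← Filter.principal_univ, Filter.eventually_prod_principal_iff] at h1
  filter_upwards [h1, eventually_ge_atTop (1:ℝ)] with T hT hT1 x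
  have h2 := hT x (mem_univ x)
  rw [dist_comm]
  convert h2 using 2
  have hT0 : 0 < T := by linarith
  simp only [Function.comp]
  change _ = (((volume.restrict (Icc (0:ℝ) 1)).map (Φ (T, x))) E).toReal
  rw [Measure.map_apply (hΦc _).measurable hEm,
    Measure.restrict_apply ((hΦc _).measurable hEm)]
  have hmem : ∀ y : ℝ, ∀ i, (y : UnitAddCircle) ∈ (fun x : ℝ => (x : UnitAddCircle)) '' J i ↔
      Int.fract y ∈ J i := by
    intro y i
    have hf : ((Int.fract y : ℝ) : UnitAddCircle) = (y : UnitAddCircle) := by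
      exact AddCircle.coe_fract y
    constructor
    · rintro ⟨z, hz, hzy⟩
      have hzy' : (z : UnitAddCircle) = ((Int.fract y : ℝ) : UnitAddCircle) := by
        rw [hf]; exact hzy
      have : z = Int.fract y := (AddCircle.coe_eq_coe_iff_of_mem_Ico (p := 1) (a := 0)
        (by simpa using hJ i hz) ⟨Int.fract_nonneg y, by simpa using Int.fract_lt_one y⟩).1 hzy'
      exact this ▸ hz
    · intro hy
      exact ⟨_, hy, hf⟩
  have hset : Φ (T, x) ⁻¹' E ∩ Icc 0 1 = (fun s => T * s) ⁻¹' {t : ℝ | t ∈ Set.Icc (0 : ℝ) T ∧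
      (fun i => Int.fract (g i x * t ^ γ i)) ∈ univ.pi J} := by
    ext s
    simp only [mem_inter_iff, mem_preimage, hE, Set.mem_pi, mem_univ, true_imp_iff, hΦ, hmem,
      Set.mem_ofPred_eq, max_eq_left hT1, mem_Icc]
    rw [and_comm]
    refine and_congr (and_congr ?_ ?_) Iff.rfl
    · simp [hT0]
    · constructor <;> intro h <;> nlinarith
  rw [hset, Real.volume_preimage_mul_left hT0.ne', ENNReal.toReal_mul,
    ENNReal.toReal_ofReal (abs_nonneg _), abs_of_pos (by positivity)]
  ring
end

section
/- Let U ⊆ ℝ^m be a nonempty connected open set, let a : U → ℝ be continuous, and set A = {(x,t) ∈ U × ℝ : t > a(x)}. Let J be a nonempty finite index set; for each j ∈ J let f_j : U → ℂ be real-analytic and not identically zero, and let φ_j(x,t) = Σ_{k=1}^{d} φ_{j,k}(x)·t^k, where d ≥ 1 and each φ_{j,k} : U → ℝ is real-analytic, such that the functions φ_j (j ∈ J) on U × ℝ are pairwise distinct and at least one φ_j is not identically zero. Define f : A → ℂ by f(x,t) = Σ_{j∈J} f_j(x)·e^{iφ_j(x,t)}. Then there exist an integer n ≥ 1, real-analytic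 functions c₁,…,c_n : U → ℝ, positive integers γ₁,…,γ_n, pairwise distinct tuples (α_j)_{j∈J} in ℤ^n, and a Lebesgue measurable set B ⊆ U with vol_m(U ∖ B) = 0, such that, setting ψ(x,t) = (c₁(x)·t^{γ₁},…,c_n(x)·t^{γ_n}) and F(x,z) = Σ_{j∈J} f_j(x)·e^{2πi(α_j·z)} for z ∈ ℝ^n: (i) f(x,t) = F(x,ψ(x,t)) for all (x,t) ∈ A; (ii) for every x ∈ B the function z ↦ F(x,z) is nonconstant on ℝ^n; (iii) for every open set Ω ⊆ U and every real number λ < vol_m(Ω) there exist a compact set K ⊆ Ω ∩ B with vol_m(K) ≥ λ and a real number T₀ with K × [T₀,+∞) ⊆ A such that the map (x,t) ↦ ψ(x, T₀ + t), defined on K × [0,+∞), is c.u.d. mod 1 on K. -/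
open MeasureTheory Filter Set

lemma ae_fderiv_zero_real {m : ℕ} (U : Set (Fin m → ℝ)) (hU : IsOpen U)
    (h : (Fin m → ℝ) → ℝ) (hh : DifferentiableOn ℝ h U) :
    ∀ᵐ x, x ∈ U → h x = 0 → fderiv ℝ h x = 0 := by
  set s : Set (Fin m → ℝ) := {x | x ∈ U ∧ h x = 0} with hs
  have hsm : MeasurableSet s := by
    have h1 : MeasurableSet (U ∩ (h ⁻¹' {0})) := by
      obtain ⟨t, ht, hte⟩ := (continuousOn_iff_isClosed.1 hh.continuousOn) {0} isClosed_singleton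
      rw [inter_comm, hte]
      exact ht.measurableSet.inter hU.measurableSet
    exact h1
  have key := ApproximatesLinearOn.norm_fderiv_sub_le (μ := (volume : Measure (Fin m → ℝ)))
    (f := fun x => h x • (1 : Fin m → ℝ)) (A := 0) (δ := 0) (s := s) (by
      intro x hx y hy
      simp [hx.2, hy.2]) hsm (fun x => (fderiv ℝ h x).smulRight (1 : Fin m → ℝ)) (by
      intro x hx
      have := (hh.differentiableAt (hU.mem_nhds hx.1)).hasFDerivAt
      exact (this.smul_const (1 : Fin m → ℝ)).hasFDerivWithinAt)
  rw [ae_restrict_iff' hsm] at key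
  filter_upwards [key] with x hx hxU hx0
  have h2 := hx ⟨hxU, hx0⟩
  have h3 : fderiv ℝ h x = 0 ∨ (1 : Fin m → ℝ) = 0 := by
    simpa using h2
  rcases h3 with h3 | h3
  · exact h3
  · ext1 v
    have hv : v = 0 := by
      funext i
      have := congrFun h3 i
      simp at this
    rw [hv]; simp

lemma ae_fderiv_zero {m : ℕ} (U : Set (Fin m → ℝ)) (hU : IsOpen U)
    {F : Type*} [NormedAddCommGroup F] [NormedSpace ℝ F] {ι : Type*} [Countable ι]
    (l : ι → F →L[ℝ] ℝ) (hl : ∀ v, (∀ i, l i v = 0) → v = 0)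
    (h : (Fin m → ℝ) → F) (hh : DifferentiableOn ℝ h U) :
    ∀ᵐ x, x ∈ U → h x = 0 → fderiv ℝ h x = 0 := by
  have key : ∀ᵐ x, ∀ i, x ∈ U → l i (h x) = 0 → fderiv ℝ (fun x => l i (h x)) x = 0 := by
    rw [ae_all_iff]
    intro i
    exact ae_fderiv_zero_real U hU _ ((l i).differentiable.comp_differentiableOn hh)
  filter_upwards [key] with x hx hxU hx0
  ext1 v
  apply hl
  intro i
  have h1 := hx i hxU (by rw [hx0, map_zero])
  have h2 : HasFDerivAt (fun x => l i (h x)) ((l i).comp (fderiv ℝ h x)) x :=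
    (l i).hasFDerivAt.comp x (hh.differentiableAt (hU.mem_nhds hxU)).hasFDerivAt
  rw [h2.fderiv] at h1
  exact congrArg (fun L => L v) h1

lemma analytic_zero_null {m : ℕ} (U : Set (Fin m → ℝ)) (hU : IsOpen U) (hc : IsConnected U)
    (h : (Fin m → ℝ) → ℝ) (hh : AnalyticOnNhd ℝ h U) (hne : ∃ x ∈ U, h x ≠ 0) :
    volume {x | x ∈ U ∧ h x = 0} = 0 := by
  have key : ∀ᵐ x, ∀ n : ℕ, x ∈ U → iteratedFDeriv ℝ n h x = 0 →
      fderiv ℝ (iteratedFDeriv ℝ n h) x = 0 := by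
    rw [ae_all_iff]
    intro n
    refine ae_fderiv_zero U hU (ι := Fin n → Fin m)
      (fun v => ContinuousMultilinearMap.apply ℝ (fun _ : Fin n => Fin m → ℝ) ℝ
        (fun i => Pi.basisFun ℝ (Fin m) (v i))) ?_ _ (hh.iteratedFDeriv n).differentiableOn
    intro L hL
    apply ContinuousMultilinearMap.toMultilinearMap_injective
    apply Module.Basis.ext_multilinear (fun _ => Pi.basisFun ℝ (Fin m))
    intro v
    simpa using hL v
  have : ∀ᵐ x, ¬ (x ∈ U ∧ h x = 0) := by
    filter_upwards [key] with x hx ⟨hxU, hx0⟩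
    have hall : ∀ n, iteratedFDeriv ℝ n h x = 0 := by
      intro n
      induction n with
      | zero => ext v; simpa using hx0
      | succ n ih =>
        ext v
        rw [iteratedFDeriv_succ_apply_left, hx n hxU ih]
        simp
    obtain ⟨p, r, hp⟩ := hh x hxU
    have hev : h =ᶠ[nhds x] 0 := by
      filter_upwards [Metric.eball_mem_nhds x hp.r_pos] with y hy
      have h1 := hp.hasSum_iteratedFDeriv (y := y - x) (by
        simpa [edist_eq_enorm_sub] using hy)
      simp only [hall] at h1
      simp only [zero_apply, smul_zero, add_sub_cancel] at h1
      exact h1.unique hasSum_zero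
    obtain ⟨y, hy, hy0⟩ := hne
    exact hy0 (hh.eqOn_zero_of_preconnected_of_eventuallyEq_zero hc.isPreconnected hxU hev hy)
  simpa [ae_iff] using this


lemma basis_lemma {m : ℕ} (U : Set (Fin m → ℝ)) {J : Type} [Fintype J]
    (g : J → (Fin m → ℝ) → ℝ) (hg : ∀ j, AnalyticOnNhd ℝ (g j) U) :
    ∃ r : ℕ, ∃ b : Fin r → (Fin m → ℝ) → ℝ, (∀ i, AnalyticOnNhd ℝ (b i) U) ∧
    ∃ β : J → Fin r → ℤ, (∀ j, ∀ x ∈ U, g j x = ∑ i, (β j i : ℝ) * b i x) ∧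
    ∀ v : Fin r → ℤ, v ≠ 0 → ∃ x ∈ U, ∑ i, (v i : ℝ) * b i x ≠ 0 := by
  classical
  let G : J → (U → ℝ) := fun j x => g j x
  let M : Submodule ℤ (U → ℝ) := Submodule.span ℤ (range G)
  have : Module.Finite ℤ M := Module.Finite.span_of_finite ℤ (finite_range G)
  have : Module.Free ℤ M := inferInstance
  let B := Module.finBasis ℤ M
  have hB : ∀ i, ∃ w : J → ℤ, ∑ j, w j • G j = (B i : U → ℝ) := fun i =>
    (Submodule.mem_span_range_iff_exists_fun ℤ).1 (B i).2
  choose w hw using hB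
  have hval : ∀ i (x : U), (∑ j, (w i j : ℝ) * g j x) = (B i : U → ℝ) x := by
    intro i x
    rw [← hw i]
    simp [G]
  refine ⟨_, fun i x => ∑ j, (w i j : ℝ) * g j x, ?_, 
    fun j => B.repr ⟨G j, Submodule.subset_span ⟨j, rfl⟩⟩, ?_, ?_⟩
  · intro i x hx
    exact Finset.analyticAt_fun_sum _ (fun j _ => analyticAt_const.mul (hg j x hx))
  · intro j x hx
    have h1 := congrArg (fun v : M => (v : U → ℝ) ⟨x, hx⟩)
      (B.sum_repr ⟨G j, Submodule.subset_span ⟨j, rfl⟩⟩)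
    simp only at h1
    have h2 : g j x = G j ⟨x, hx⟩ := rfl
    rw [h2, ← h1]
    simp only [hval _ ⟨x, hx⟩]
    rw [AddSubmonoidClass.coe_finsetSum, Finset.sum_apply]
    refine Finset.sum_congr rfl fun i _ => ?_
    simp
  · intro v hv
    by_contra hcon
    push Not at hcon
    apply hv
    have h0 : ∑ i, v i • B i = 0 := by
      apply Subtype.ext
      funext x
      have := hcon x x.2
      simp only [hval _ x] at this
      simpa using this
    funext i
    exact Fintype.linearIndependent_iff.1 B.linearIndependent v h0 i

/-- Combining all degrees. -/
lemma basis_all {m : ℕ} (U : Set (Fin m → ℝ)) {J : Type} [Fintype J] (d : ℕ)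
    (g : J → ℕ → (Fin m → ℝ) → ℝ) (hg : ∀ j k, AnalyticOnNhd ℝ (g j k) U) :
    ∃ n : ℕ, ∃ c : Fin n → (Fin m → ℝ) → ℝ, (∀ i, AnalyticOnNhd ℝ (c i) U) ∧
    ∃ γ : Fin n → ℕ, (∀ i, 0 < γ i) ∧
    ∃ α : J → Fin n → ℤ,
      (∀ j, ∀ x ∈ U, ∀ t : ℝ, ∑ k ∈ Finset.Icc 1 d, g j k x * t ^ k =
        ∑ i, (α j i : ℝ) * (c i x * t ^ γ i)) ∧
    ∀ v : Fin n → ℤ, ∀ k, (∃ i, γ i = k ∧ v i ≠ 0) →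
      ∃ x ∈ U, ∑ i with γ i = k, (v i : ℝ) * c i x ≠ 0 := by
  classical
  choose r b hb β hβ hind using fun k : ℕ => basis_lemma U (fun j => g j k) (fun j => hg j k)
  let ι := Σ k : Fin d, Fin (r (k + 1))
  let e : ι ≃ Fin (Fintype.card ι) := Fintype.equivFin ι
  let C : ι → (Fin m → ℝ) → ℝ := fun q => b (q.1 + 1) q.2
  let A : J → ι → ℤ := fun j q => β (q.1 + 1) j q.2
  let Γ : ι → ℕ := fun q => q.1 + 1
  refine ⟨Fintype.card ι, fun i => C (e.symm i), fun i => hb _ _,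
    fun i => Γ (e.symm i), fun i => Nat.succ_pos _,
    fun j i => A j (e.symm i), ?_, ?_⟩
  · intro j x hx t
    rw [← Equiv.sum_comp e]
    simp only [Equiv.symm_apply_apply]
    rw [Fintype.sum_sigma]
    have : Finset.Icc 1 d = Finset.Ico (0 + 1) (d + 1) := by ext; simp
    rw [this, ← Finset.sum_Ico_add', ← Finset.range_eq_Ico, Finset.sum_range]
    refine Finset.sum_congr rfl fun k _ => ?_
    rw [hβ (k + 1) j x hx, Finset.sum_mul]
    refine Finset.sum_congr rfl fun i _ => by simp only [A, C, Γ]; ring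
  · intro v k ⟨i, hik, hvi⟩
    let k' : Fin d := (e.symm i).1
    have hk' : (k' : ℕ) + 1 = k := hik
    obtain ⟨x, hx, hne⟩ := hind (k' + 1) (fun l => v (e ⟨k', l⟩)) (by
      intro h
      apply hvi
      have := congrFun h (e.symm i).2
      simpa [k'] using this)
    refine ⟨x, hx, ?_⟩
    rw [Finset.sum_filter, ← Equiv.sum_comp e]
    simp only [Equiv.symm_apply_apply]
    rw [Fintype.sum_sigma, Finset.sum_eq_single k']
    · simpa [hk', C, Γ] using hne
    · intro l _ hl
      refine Finset.sum_eq_zero fun q _ => ?_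
      rw [if_neg]
      intro h
      apply hl
      apply Fin.ext
      simp only [Γ] at h
      lia
    · simp

lemma exp_test {n : ℕ} (δ : Fin n → ℤ) (hδ : δ ≠ 0) :
    ∃ h : Fin n → ℝ, ∑ i, (δ i : ℝ) * h i = 1 / 2 := by
  classical
  obtain ⟨i, hi⟩ := Function.ne_iff.1 hδ
  refine ⟨Pi.single i (1 / (2 * (δ i : ℝ))), ?_⟩
  have : (δ i : ℝ) ≠ 0 := by exact_mod_cast hi
  rw [Finset.sum_eq_single i]
  · simp; field_simp
  · intro j _ hj; simp [hj]
  · simp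

noncomputable def torusChar {n : ℕ} (α : Fin n → ℤ) : Multiplicative (Fin n → ℝ) →* ℂ where
  toFun z := Complex.exp (2 * (Real.pi : ℂ) * Complex.I *
    ((∑ i, (α i : ℝ) * (Multiplicative.toAdd z) i : ℝ) : ℂ))
  map_one' := by simp
  map_mul' x y := by
    rw [← Complex.exp_add, ← mul_add, ← Complex.ofReal_add, ← Finset.sum_add_distrib]
    simp [mul_add]

lemma torusChar_apply {n : ℕ} (α : Fin n → ℤ) (z : Fin n → ℝ) :
    torusChar α (Multiplicative.ofAdd z) = Complex.exp (2 * (Real.pi : ℂ) * Complex.I *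
    ((∑ i, (α i : ℝ) * z i : ℝ) : ℂ)) := rfl

lemma torusChar_inj {n : ℕ} : Function.Injective (torusChar (n := n)) := by
  intro α α' h
  by_contra hne
  obtain ⟨z, hz⟩ := exp_test (α - α') (sub_ne_zero.2 hne)
  have h1 := DFunLike.congr_fun h (Multiplicative.ofAdd z)
  rw [torusChar_apply, torusChar_apply] at h1
  have h2 : ∑ i, (α i : ℝ) * z i = ∑ i, (α' i : ℝ) * z i + 1 / 2 := by
    rw [← hz, ← Finset.sum_add_distrib]
    refine Finset.sum_congr rfl fun i _ => ?_
    simp; ring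
  rw [h2, Complex.ofReal_add, mul_add, Complex.exp_add] at h1
  have h3 : Complex.exp (2 * (Real.pi : ℂ) * Complex.I * ((1 / 2 : ℝ) : ℂ)) = -1 := by
    rw [← Complex.exp_pi_mul_I]; congr 1; push_cast; ring
  rw [h3] at h1
  have h4 := Complex.exp_ne_zero (2 * (Real.pi : ℂ) * Complex.I *
    ((∑ i, (α' i : ℝ) * z i : ℝ) : ℂ))
  apply h4
  linear_combination (-1/2) * h1

lemma nonconst {n : ℕ} {J : Type} [Fintype J] (α : J → Fin n → ℤ) (hα : Function.Injective α)
    (w : J → ℂ) (j : J) (hj : α j ≠ 0) (hw : w j ≠ 0) :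
    ∃ z z' : Fin n → ℝ,
        (∑ j, w j * Complex.exp (2 * (Real.pi : ℂ) * Complex.I *
            ((∑ i, (α j i : ℝ) * z i : ℝ) : ℂ))) ≠
        (∑ j, w j * Complex.exp (2 * (Real.pi : ℂ) * Complex.I *
            ((∑ i, (α j i : ℝ) * z' i : ℝ) : ℂ))) := by
  by_contra hcon
  push Not at hcon
  obtain ⟨h, hh⟩ := exp_test (α j) hj
  have hli := (linearIndependent_monoidHom (Multiplicative (Fin n → ℝ)) ℂ).comp
    (fun j => torusChar (α j)) (torusChar_inj.comp hα)
  have h0 := Fintype.linearIndependent_iff.1 hli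
    (fun j => w j * (torusChar (α j) (Multiplicative.ofAdd h) - 1)) (by
      funext z
      obtain ⟨z, rfl⟩ := Multiplicative.ofAdd.surjective z
      have h1 := hcon (h + z) z
      simp only [← torusChar_apply, ofAdd_add, map_mul] at h1
      rw [← sub_eq_zero, ← Finset.sum_sub_distrib] at h1
      simp only [Finset.sum_apply, Pi.smul_apply, Function.comp, smul_eq_mul, Pi.zero_apply]
      rw [← h1]
      refine Finset.sum_congr rfl fun i _ => by ring) j
  rw [torusChar_apply, hh] at h0
  have h3 : Complex.exp (2 * (Real.pi : ℂ) * Complex.I * ((1 / 2 : ℝ) : ℂ)) = -1 := by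
    rw [← Complex.exp_pi_mul_I]; congr 1; push_cast; ring
  rw [h3] at h0
  rcases mul_eq_zero.1 h0 with h | h
  · exact hw h
  · norm_num at h

def toTorus {n : ℕ} (y : Fin n → ℝ) : UnitAddTorus (Fin n) := fun i => (y i : UnitAddCircle)

lemma continuous_toTorus {n : ℕ} : Continuous (toTorus (n := n)) := by
  unfold toTorus
  refine continuous_pi fun i => ?_
  exact (AddCircle.continuous_mk' 1).comp (continuous_apply i)

lemma isOpenMap_toTorus {n : ℕ} : IsOpenMap (toTorus (n := n)) := by
  have : toTorus (n := n) = Pi.map (fun _ => ((↑) : ℝ → UnitAddCircle)) := rfl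
  rw [this]
  exact IsOpenMap.piMap (fun _ => QuotientAddGroup.isOpenMap_coe)
    (Eventually.of_forall fun _ => QuotientAddGroup.mk_surjective)

lemma toTorus_eq_iff {n : ℕ} (y z : Fin n → ℝ) (hz : ∀ i, z i ∈ Ico (0 : ℝ) 1) :
    toTorus y = toTorus z ↔ (fun i => Int.fract (y i)) = z := by
  unfold toTorus
  rw [funext_iff, funext_iff]
  refine forall_congr' fun i => ?_
  rw [Int.fract_eq_iff]
  constructor
  · intro h
    refine ⟨(hz i).1, (hz i).2, ?_⟩
    have h1 : ((y i - z i : ℝ) : UnitAddCircle) = 0 := by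
      rw [AddCircle.coe_sub, sub_eq_zero]; exact h
    rw [AddCircle.coe_eq_zero_iff] at h1
    obtain ⟨k, hk⟩ := h1
    exact ⟨k, by simpa using hk.symm⟩
  · rintro ⟨_, _, k, hk⟩
    have h1 : ((y i - z i : ℝ) : UnitAddCircle) = 0 := by
      rw [AddCircle.coe_eq_zero_iff]; exact ⟨k, by simpa using hk.symm⟩
    rw [AddCircle.coe_sub, sub_eq_zero] at h1; exact h1

lemma preimage_image_toTorus {n : ℕ} (I : Set (Fin n → ℝ)) (hI : ∀ z ∈ I, ∀ i, z i ∈ Ico (0 : ℝ) 1)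
    (y : Fin n → ℝ) : toTorus y ∈ toTorus '' I ↔ (fun i => Int.fract (y i)) ∈ I := by
  constructor
  · rintro ⟨z, hz, hzy⟩
    rw [(toTorus_eq_iff y z (hI z hz)).1 hzy.symm]; exact hz
  · intro h
    exact ⟨_, h, ((toTorus_eq_iff y _ (hI _ h)).2 rfl).symm⟩

/-- Haar measure on the torus. -/
noncomputable def torusMeas (n : ℕ) : Measure (UnitAddTorus (Fin n)) :=
  Measure.map toTorus (volume.restrict (univ.pi fun _ => Ico (0 : ℝ) 1))

instance torusMeas_prob (n : ℕ) : IsProbabilityMeasure (torusMeas n) := by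
  unfold torusMeas
  have : IsProbabilityMeasure ((volume : Measure (Fin n → ℝ)).restrict
      (univ.pi fun _ => Ico (0 : ℝ) 1)) := by
    constructor
    simp [volume_pi_pi]
  exact Measure.isProbabilityMeasure_map continuous_toTorus.measurable.aemeasurable

noncomputable def torusPM (n : ℕ) : ProbabilityMeasure (UnitAddTorus (Fin n)) :=
  ⟨torusMeas n, inferInstance⟩

lemma torusPM_coe (n : ℕ) : (torusPM n : Measure (UnitAddTorus (Fin n))) = torusMeas n := rfl

lemma mFourier_toTorus {n : ℕ} (β : Fin n → ℤ) (y : Fin n → ℝ) :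
    UnitAddTorus.mFourier β (toTorus y) = Complex.exp (2 * (Real.pi : ℂ) * Complex.I *
      ((∑ i, (β i : ℝ) * y i : ℝ) : ℂ)) := by
  simp only [UnitAddTorus.mFourier, ContinuousMap.coe_mk, toTorus, fourier_coe_apply]
  rw [← Complex.exp_sum]
  congr 1
  push_cast
  rw [Finset.mul_sum]
  refine Finset.sum_congr rfl fun i _ => ?_
  simp; ring

lemma integral_mFourier {n : ℕ} (β : Fin n → ℤ) (hβ : β ≠ 0) :
    ∫ z, UnitAddTorus.mFourier β z ∂(torusMeas n) = 0 := by
  unfold torusMeas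
  rw [integral_map continuous_toTorus.measurable.aemeasurable
    (UnitAddTorus.mFourier β).continuous.aestronglyMeasurable]
  simp only [UnitAddTorus.mFourier, ContinuousMap.coe_mk, toTorus]
  rw [volume_pi, Measure.restrict_pi_pi]
  rw [integral_fintype_prod_eq_prod (𝕜 := ℂ)
    (f := fun i (y : ℝ) => fourier (β i) (y : UnitAddCircle))]
  obtain ⟨i, hi⟩ := Function.ne_iff.1 hβ
  apply Finset.prod_eq_zero (Finset.mem_univ i)
  rw [integral_Ico_eq_integral_Ioc, ← intervalIntegral.integral_of_le zero_le_one]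
  simp only [fourier_coe_apply]
  have hc : (2 * (Real.pi : ℂ) * Complex.I * (β i)) ≠ 0 := by
    simp only [ne_eq, mul_eq_zero, not_or]
    refine ⟨⟨⟨by norm_num, by exact_mod_cast Real.pi_ne_zero⟩, Complex.I_ne_zero⟩, ?_⟩
    exact_mod_cast hi
  have h1 := integral_exp_mul_complex (a := 0) (b := 1) hc
  simp only [Complex.ofReal_one, div_one]
  rw [h1]
  have : Complex.exp (2 * (Real.pi : ℂ) * Complex.I * (β i) * ((1 : ℝ) : ℂ)) = 1 := by
    rw [Complex.exp_eq_one_iff]; exact ⟨β i, by push_cast; ring⟩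
  rw [this]; simp

lemma weak_of_fourier {n : ℕ} {ι : Type*} {L : Filter ι}
    (ν : ι → ProbabilityMeasure (UnitAddTorus (Fin n)))
    (h : ∀ β : Fin n → ℤ, β ≠ 0 → Tendsto (fun p => ∫ z, UnitAddTorus.mFourier β z ∂(ν p : Measure (UnitAddTorus (Fin n)))) L
      (nhds 0)) :
    Tendsto ν L (nhds (torusPM n)) := by
  have hintg : ∀ (μ : Measure (UnitAddTorus (Fin n))) [IsProbabilityMeasure μ]
      (G : C(UnitAddTorus (Fin n), ℂ)), Integrable G μ := by
    intro μ _ G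
    exact Integrable.of_bound G.continuous.aestronglyMeasurable ‖G‖
      (Eventually.of_forall fun z => G.norm_coe_le_norm z)
  have hspan : ∀ G ∈ Submodule.span ℂ (range (UnitAddTorus.mFourier (d := Fin n))),
      Tendsto (fun p => ∫ z, G z ∂(ν p : Measure (UnitAddTorus (Fin n)))) L (nhds (∫ z, G z ∂(torusMeas n))) := by
    intro G hG
    induction hG using Submodule.span_induction with
    | mem G hG =>
      obtain ⟨β, rfl⟩ := hG
      by_cases hβ : β = 0
      · subst hβ
        simpa [UnitAddTorus.mFourier_zero] using tendsto_const_nhds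
      · rw [integral_mFourier β hβ]; exact h β hβ
    | zero => simpa using tendsto_const_nhds
    | add G H _ _ hG hH =>
      have := hG.add hH
      simp only [ContinuousMap.add_apply]
      rw [integral_add (hintg _ G) (hintg _ H)]
      refine this.congr fun p => ?_
      rw [integral_add (hintg _ G) (hintg _ H)]
    | smul c G _ hG =>
      simp only [ContinuousMap.smul_apply, integral_smul]
      exact hG.const_smul c
  have hall : ∀ G : C(UnitAddTorus (Fin n), ℂ),
      Tendsto (fun p => ∫ z, G z ∂(ν p : Measure (UnitAddTorus (Fin n)))) L (nhds (∫ z, G z ∂(torusMeas n))) := by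
    intro G
    rw [Metric.tendsto_nhds]
    intro ε hε
    have hG : G ∈ closure
        ((Submodule.span ℂ (range (UnitAddTorus.mFourier (d := Fin n)))) : Set _) := by
      rw [← Submodule.topologicalClosure_coe, UnitAddTorus.span_mFourier_closure_eq_top]
      trivial
    obtain ⟨H, hH, hGH⟩ := Metric.mem_closure_iff.1 hG (ε / 3) (by positivity)
    have hd : ∀ (μ : Measure (UnitAddTorus (Fin n))) [IsProbabilityMeasure μ],
        dist (∫ z, G z ∂μ) (∫ z, H z ∂μ) ≤ ε / 3 := by
      intro μ _
      rw [dist_eq_norm, ← integral_sub (hintg _ G) (hintg _ H)]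
      have := norm_integral_le_of_norm_le_const (μ := μ) (f := fun z => G z - H z) (C := ε / 3)
        (Eventually.of_forall fun z => by
          rw [← dist_eq_norm]
          exact (ContinuousMap.dist_apply_le_dist z).trans hGH.le)
      simpa using this
    filter_upwards [Metric.tendsto_nhds.1 (hspan H hH) (ε / 3) (by positivity)] with p hp
    have h1 := hd (ν p)
    have h2 := hd (torusMeas n)
    have h3 := dist_triangle4 (∫ z, G z ∂(ν p : Measure (UnitAddTorus (Fin n)))) (∫ z, H z ∂(ν p : Measure (UnitAddTorus (Fin n))))
      (∫ z, H z ∂(torusMeas n)) (∫ z, G z ∂(torusMeas n))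
    rw [dist_comm (∫ z, H z ∂(torusMeas n))] at h3
    linarith
  rw [ProbabilityMeasure.tendsto_iff_forall_integral_rclike_tendsto (𝕜 := ℂ)]
  intro G
  rw [torusPM_coe]
  exact hall G.toContinuousMap

lemma torusMeas_box {n : ℕ} (I : Set (Fin n → ℝ)) (hI : IsBox I) :
    MeasurableSet (toTorus '' I) ∧ torusMeas n (toTorus '' I) = volume I ∧
    torusMeas n (frontier (toTorus '' I)) = 0 := by
  obtain ⟨J, hJ, hJc, -, rfl⟩ := hI
  have hIm : MeasurableSet (univ.pi J) := MeasurableSet.univ_pi fun i => (hJc i).measurableSet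
  have hsub : ∀ z ∈ univ.pi J, ∀ i, z i ∈ Ico (0 : ℝ) 1 := fun z hz i => hJ i (hz i trivial)
  have hpre := preimage_image_toTorus (univ.pi J) hsub
  have hfr : ∀ y : Fin n → ℝ, (∀ i, y i ∈ Ico (0 : ℝ) 1) → (fun i => Int.fract (y i)) = y := by
    intro y hy
    funext i
    exact Int.fract_eq_self.2 (hy i)
  have hEm : MeasurableSet (toTorus '' (univ.pi J)) := by
    apply hIm.image_of_continuousOn_injOn continuous_toTorus.continuousOn
    intro y hy z hz hyz
    rw [toTorus_eq_iff y z (hsub z hz), hfr y (hsub y hy)] at hyz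
    exact hyz
  refine ⟨hEm, ?_, ?_⟩
  · unfold torusMeas
    rw [Measure.map_apply continuous_toTorus.measurable hEm,
      Measure.restrict_apply (continuous_toTorus.measurable hEm)]
    congr 1
    ext y
    constructor
    · rintro ⟨h1, h2⟩
      have := (hpre y).1 h1
      rwa [hfr y (fun i => h2 i trivial)] at this
    · intro h
      exact ⟨⟨y, h, rfl⟩, fun i _ => hsub y h i⟩
  · unfold torusMeas
    rw [Measure.map_apply continuous_toTorus.measurable isClosed_frontier.measurableSet,
      isOpenMap_toTorus.preimage_frontier_eq_frontier_preimage continuous_toTorus]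
    have hae : (univ.pi fun _ : Fin n => Ico (0 : ℝ) 1) =ᵐ[volume]
        (univ.pi fun _ : Fin n => Ioo (0 : ℝ) 1) := by
      have := (Measure.univ_pi_Ioo_ae_eq_Icc (μ := fun _ : Fin n => (volume : Measure ℝ))
        (f := fun _ => 0) (g := fun _ => 1))
      have h2 := (Measure.univ_pi_Ico_ae_eq_Icc (μ := fun _ : Fin n => (volume : Measure ℝ))
        (f := fun _ => 0) (g := fun _ => 1))
      exact h2.trans this.symm
    rw [Measure.restrict_congr_set hae]
    have hO : IsOpen (univ.pi fun _ : Fin n => Ioo (0 : ℝ) 1) :=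
      isOpen_set_pi finite_univ fun _ _ => isOpen_Ioo
    rw [Measure.restrict_apply isClosed_frontier.measurableSet]
    rw [← frontier_inter_open_inter hO]
    have heq : toTorus ⁻¹' (toTorus '' univ.pi J) ∩ (univ.pi fun _ : Fin n => Ioo (0 : ℝ) 1) =
        univ.pi J ∩ (univ.pi fun _ : Fin n => Ioo (0 : ℝ) 1) := by
      ext y
      simp only [mem_inter_iff, mem_preimage]
      refine and_congr_left fun h => ?_
      rw [hpre y, hfr y (fun i => Ioo_subset_Ico_self (h i trivial))]
    rw [heq, frontier_inter_open_inter hO]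
    have hconv : Convex ℝ (univ.pi J) := convex_pi fun i _ => (hJc i).convex
    exact measure_mono_null inter_subset_left (hconv.addHaar_frontier volume)

lemma weyl_s11 {X : Type*} {n : ℕ} (ψ : X → ℝ → Fin n → ℝ) (hψ : ∀ x, Continuous (ψ x))
    (h : ∀ β : Fin n → ℤ, β ≠ 0 → ∀ ε > 0, ∃ T₁ : ℝ, ∀ T ≥ T₁, ∀ x : X,
      ‖∫ t in (0 : ℝ)..T, Complex.exp (2 * (Real.pi : ℂ) * Complex.I *
      ((∑ i, (β i : ℝ) * ψ x t i : ℝ) : ℂ))‖ ≤ ε * T) :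
    IsCudModOneOn ψ := by
  intro I hI
  obtain ⟨hEm, hEv, hEf⟩ := torusMeas_box I hI
  have hsub : ∀ z ∈ I, ∀ i, z i ∈ Ico (0 : ℝ) 1 := by
    obtain ⟨J, hJ, -, -, rfl⟩ := hI
    exact fun z hz i => hJ i (hz i trivial)
  let M : ℝ → Measure ℝ := fun T => ENNReal.ofReal (max T 1)⁻¹ • volume.restrict (Icc 0 (max T 1))
  have hpos : ∀ T : ℝ, 0 < max T 1 := fun T => lt_max_of_lt_right one_pos
  have hM : ∀ T, IsProbabilityMeasure (M T) := by
    intro T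
    constructor
    simp only [M, Measure.smul_apply, Measure.restrict_apply_univ, Real.volume_Icc, smul_eq_mul,
      sub_zero]
    rw [← ENNReal.ofReal_mul (inv_nonneg.2 (hpos T).le), inv_mul_cancel₀ (hpos T).ne',
      ENNReal.ofReal_one]
  have hcont : ∀ x, Continuous (fun t => toTorus (ψ x t)) := fun x => continuous_toTorus.comp (hψ x)
  let ν : ℝ × X → ProbabilityMeasure (UnitAddTorus (Fin n)) := fun p =>
    ⟨Measure.map (fun t => toTorus (ψ p.2 t)) (M p.1),
      Measure.isProbabilityMeasure_map (hcont p.2).measurable.aemeasurable⟩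
  have hw : Tendsto ν (atTop ×ˢ ⊤) (nhds (torusPM n)) := by
    apply weak_of_fourier
    intro β hβ
    rw [Metric.tendsto_nhds]
    intro ε hε
    obtain ⟨T₁, hT₁⟩ := h β hβ (ε / 2) (by positivity)
    have hev : ∀ᶠ p : ℝ × X in atTop ×ˢ ⊤, max T₁ 1 ≤ p.1 :=
      tendsto_fst.eventually (eventually_ge_atTop _)
    filter_upwards [hev] with p hp
    have hp1 : 1 ≤ p.1 := (le_max_right _ _).trans hp
    have hpT : T₁ ≤ p.1 := (le_max_left _ _).trans hp
    rw [dist_zero_right]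
    have hcoe : ((ν p : ProbabilityMeasure _) : Measure (UnitAddTorus (Fin n))) =
        Measure.map (fun t => toTorus (ψ p.2 t)) (M p.1) := rfl
    rw [hcoe]
    rw [integral_map (hcont p.2).measurable.aemeasurable
      (UnitAddTorus.mFourier β).continuous.aestronglyMeasurable]
    simp only [M, mFourier_toTorus]
    rw [integral_smul_measure, max_eq_left hp1, integral_Icc_eq_integral_Ioc,
      ← intervalIntegral.integral_of_le (by linarith), norm_smul,
      ENNReal.toReal_ofReal (by positivity), Real.norm_of_nonneg (by positivity)]
    have h2 := hT₁ p.1 hpT p.2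
    have hp0 : 0 < p.1 := by linarith
    calc _ ≤ p.1⁻¹ * (ε / 2 * p.1) := by gcongr
      _ = ε / 2 := by field_simp
      _ < ε := by linarith
  have hconv := ProbabilityMeasure.tendsto_measure_of_null_frontier_of_tendsto' hw
    (E := toTorus '' I) hEf
  rw [torusPM_coe] at hconv
  have hconv2 := (ENNReal.tendsto_toReal (measure_ne_top (torusMeas n) (toTorus '' I))).comp hconv
  rw [hEv] at hconv2
  rw [tendstoUniformly_iff_tendsto, tendsto_uniformity_iff_dist_tendsto_zero]
  have hconv3 := (tendsto_const_nhds (x := (volume I).toReal)).dist hconv2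
  rw [dist_self] at hconv3
  refine hconv3.congr' ?_
  have hev : ∀ᶠ p : ℝ × X in atTop ×ˢ ⊤, 1 ≤ p.1 :=
    tendsto_fst.eventually (eventually_ge_atTop _)
  filter_upwards [hev] with p hp
  congr 1
  have hcoe : ((ν p : ProbabilityMeasure _) : Measure (UnitAddTorus (Fin n))) =
      Measure.map (fun t => toTorus (ψ p.2 t)) (M p.1) := rfl
  have hp0 : 0 < p.1 := by linarith
  simp only [Function.comp]
  rw [hcoe, Measure.map_apply (hcont p.2).measurable hEm]
  simp only [M]
  rw [Measure.smul_apply, Measure.restrict_apply ((hcont p.2).measurable hEm), max_eq_left hp,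
    smul_eq_mul, ENNReal.toReal_mul, ENNReal.toReal_ofReal (by positivity), mul_comm, div_eq_mul_inv]
  congr 3
  ext t
  simp only [mem_inter_iff, mem_preimage, mem_ofPred_eq]
  rw [preimage_image_toTorus I hsub, and_comm]

lemma osc_bound_s11 (P P' P'' : ℝ → ℝ) (hP : ∀ t, HasDerivAt P (P' t) t)
    (hP' : ∀ t, HasDerivAt P' (P'' t) t) (hc'' : Continuous P'') (A B c δ : ℝ) (hAB : A ≤ B)
    (hc : 0 < c) (h1 : ∀ t ∈ Icc A B, c ≤ |P' t|) (h2 : ∀ t ∈ Icc A B, |P'' t| ≤ δ * (P' t) ^ 2) :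
    ‖∫ t in A..B, Complex.exp (Complex.I * (P t : ℂ))‖ ≤ 2 / c + δ * (B - A) := by
  have hcP : Continuous P := continuous_iff_continuousAt.2 fun t => (hP t).continuousAt
  have hcP' : Continuous P' := continuous_iff_continuousAt.2 fun t => (hP' t).continuousAt
  have hne : ∀ t ∈ Icc A B, (P' t : ℂ) ≠ 0 := by
    intro t ht h
    have h3 := h1 t ht
    have : P' t = 0 := by exact_mod_cast h
    rw [this, abs_zero] at h3
    linarith
  have hexp : ∀ t, ‖Complex.exp (Complex.I * (P t : ℂ))‖ = 1 := by
    intro t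
    rw [mul_comm]; exact Complex.norm_exp_ofReal_mul_I _
  set F : ℝ → ℂ := fun t => Complex.exp (Complex.I * (P t : ℂ)) / (Complex.I * (P' t : ℂ)) with hF
  set R : ℝ → ℂ := fun t => Complex.exp (Complex.I * (P t : ℂ)) * (P'' t : ℂ) /
    (Complex.I * (P' t : ℂ) ^ 2) with hR
  have hFd : ∀ t ∈ uIcc A B, HasDerivAt F (Complex.exp (Complex.I * (P t : ℂ)) - R t) t := by
    intro t ht
    rw [uIcc_of_le hAB] at ht
    have e1 : HasDerivAt (fun t => Complex.exp (Complex.I * (P t : ℂ)))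
        (Complex.exp (Complex.I * (P t : ℂ)) * (Complex.I * (P' t : ℂ))) t :=
      ((hP t).ofReal_comp.const_mul Complex.I).cexp
    have e2 : HasDerivAt (fun t => Complex.I * (P' t : ℂ)) (Complex.I * (P'' t : ℂ)) t :=
      (hP' t).ofReal_comp.const_mul Complex.I
    have hn := hne t ht
    have e3 := e1.div e2 (mul_ne_zero Complex.I_ne_zero hn)
    refine HasDerivAt.congr_deriv (f := F) e3 ?_
    have hI := Complex.I_ne_zero
    rw [hR]
    field_simp
  have hRc : ContinuousOn R (uIcc A B) := by
    rw [uIcc_of_le hAB]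
    refine ContinuousOn.div (by fun_prop) (by fun_prop) ?_
    intro t ht
    exact mul_ne_zero Complex.I_ne_zero (pow_ne_zero 2 (hne t ht))
  have hEc : Continuous fun t => Complex.exp (Complex.I * (P t : ℂ)) := by fun_prop
  have hintg := intervalIntegral.integral_eq_sub_of_hasDerivAt hFd
    ((hEc.continuousOn.sub hRc).intervalIntegrable)
  rw [intervalIntegral.integral_sub (hEc.intervalIntegrable _ _) hRc.intervalIntegrable,
    sub_eq_iff_eq_add] at hintg
  rw [hintg]
  have hFb : ∀ t ∈ Icc A B, ‖F t‖ ≤ 1 / c := by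
    intro t ht
    simp only [hF]
    rw [norm_div, hexp, norm_mul, Complex.norm_I, one_mul, Complex.norm_real, Real.norm_eq_abs]
    exact one_div_le_one_div_of_le hc (h1 t ht)
  have hRb : ‖∫ t in A..B, R t‖ ≤ δ * (B - A) := by
    have := intervalIntegral.norm_integral_le_of_norm_le_const (a := A) (b := B) (f := R) (C := δ)
      (by
        intro t ht
        rw [uIoc_of_le hAB] at ht
        have ht' : t ∈ Icc A B := Ioc_subset_Icc_self ht
        simp only [hR]
        rw [norm_div, norm_mul, hexp, norm_mul, Complex.norm_I, one_mul, one_mul, norm_pow,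
          Complex.norm_real, Complex.norm_real, Real.norm_eq_abs, Real.norm_eq_abs, sq_abs]
        have : 0 < (P' t) ^ 2 := by
          have h3 := h1 t ht'
          rw [← sq_abs]
          have : 0 < |P' t| := by linarith
          positivity
        rw [div_le_iff₀ this]
        exact h2 t ht')
    rwa [abs_of_nonneg (by linarith)] at this
  calc ‖F B - F A + ∫ t in A..B, R t‖ ≤ ‖F B - F A‖ + ‖∫ t in A..B, R t‖ := norm_add_le _ _
    _ ≤ (‖F B‖ + ‖F A‖) + ‖∫ t in A..B, R t‖ := by gcongr; exact norm_sub_le _ _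
    _ ≤ (1 / c + 1 / c) + δ * (B - A) := by
      gcongr
      · exact hFb B ⟨hAB, le_rfl⟩
      · exact hFb A ⟨le_rfl, hAB⟩
    _ = _ := by ring

lemma osc_poly {n : ℕ} (γ : Fin n → ℕ) (hγ : ∀ i, 0 < γ i) (k : ℕ) (hk : 0 < k) (ε M : ℝ)
    (hε : 0 < ε) (hM : 0 ≤ M) (δ : ℝ) (hδ : 0 < δ) :
    ∃ S : ℝ, ∀ p : Fin n → ℝ, (∀ i, |p i| ≤ M) → (∀ i, k < γ i → p i = 0) →
      ε ≤ |∑ i with γ i = k, p i| → ∀ A B, S ≤ A → A ≤ B →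
      ‖∫ t in A..B, Complex.exp (Complex.I * ((∑ i, p i * t ^ γ i : ℝ) : ℂ))‖ ≤
        4 / ε + δ * (B - A) := by
  set D : ℝ := n * (M * k ^ 2) with hD
  have hD0 : 0 ≤ D := by positivity
  have hk1 : (1 : ℝ) ≤ k := by exact_mod_cast hk
  refine ⟨max 1 (max (2 * D / ε) (4 * D / (ε ^ 2 * δ))), ?_⟩
  intro p hpM hpk hlead A B hSA hAB
  have hmain : ∀ s ∈ Icc A B, ε / 2 * s ^ (k - 1) ≤ |∑ i, p i * ((γ i : ℝ) * s ^ (γ i - 1))| ∧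
      |∑ i, p i * ((γ i : ℝ) * (((γ i - 1 : ℕ) : ℝ) * s ^ (γ i - 1 - 1)))| * s
        ≤ D * s ^ (k - 1) ∧
      1 ≤ s ∧ 4 * D / (ε ^ 2 * δ) ≤ s := by
    intro s hs
    have hSs := hSA.trans hs.1
    have hs1 : 1 ≤ s := (le_max_left _ _).trans hSs
    have hs2 : 2 * D / ε ≤ s := (le_max_left _ _).trans ((le_max_right _ _).trans hSs)
    have hs3 : 4 * D / (ε ^ 2 * δ) ≤ s := (le_max_right _ _).trans ((le_max_right _ _).trans hSs)
    have hs0 : 0 < s := by linarith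
    have hpw : s ^ k = s ^ (k - 1) * s := by rw [← pow_succ]; congr 1; lia
    refine ⟨?_, ?_, hs1, hs3⟩
    · have e1 : s * ∑ i, p i * ((γ i : ℝ) * s ^ (γ i - 1)) = ∑ i, p i * ((γ i : ℝ) * s ^ γ i) := by
        rw [Finset.mul_sum]
        refine Finset.sum_congr rfl fun i _ => ?_
        have : s ^ γ i = s ^ (γ i - 1) * s := by rw [← pow_succ]; congr 1; have := hγ i; lia
        rw [this]; ring
      have e2 : ∑ i, p i * ((γ i : ℝ) * s ^ γ i) = (∑ i with γ i = k, p i) * (k * s ^ k) +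
          ∑ i with ¬ γ i = k, p i * ((γ i : ℝ) * s ^ γ i) := by
        rw [← Finset.sum_filter_add_sum_filter_not Finset.univ (fun i => γ i = k)]
        congr 1
        rw [Finset.sum_mul]
        refine Finset.sum_congr rfl fun i hi => ?_
        rw [(Finset.mem_filter.1 hi).2]
      have e3 : |∑ i with ¬ γ i = k, p i * ((γ i : ℝ) * s ^ γ i)| ≤ D * s ^ (k - 1) := by
        calc |∑ i with ¬ γ i = k, p i * ((γ i : ℝ) * s ^ γ i)|
            ≤ ∑ i with ¬ γ i = k, |p i * ((γ i : ℝ) * s ^ γ i)| := Finset.abs_sum_le_sum_abs _ _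
          _ ≤ ∑ i with ¬ γ i = k, (M * k ^ 2 * s ^ (k - 1)) := by
            refine Finset.sum_le_sum fun i hi => ?_
            have hik : γ i ≠ k := (Finset.mem_filter.1 hi).2
            rcases lt_or_gt_of_ne hik with h | h
            · rw [abs_mul, abs_of_nonneg (by positivity : (0 : ℝ) ≤ (γ i : ℝ) * s ^ γ i), mul_assoc]
              have a1 : (γ i : ℝ) ≤ (k : ℝ) ^ 2 := by
                have : (γ i : ℝ) ≤ k := by exact_mod_cast h.le
                nlinarith
              have a2 : s ^ γ i ≤ s ^ (k - 1) := pow_le_pow_right₀ hs1 (by lia)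
              have := hpM i
              gcongr
            · rw [hpk i h]; simp; positivity
          _ ≤ ∑ i : Fin n, (M * k ^ 2 * s ^ (k - 1)) :=
            Finset.sum_le_sum_of_subset_of_nonneg (Finset.filter_subset _ _)
              (fun _ _ _ => by positivity)
          _ = D * s ^ (k - 1) := by simp [hD]; ring
      have e4 : s * |∑ i, p i * ((γ i : ℝ) * s ^ (γ i - 1))| ≥
          ε * s ^ k - D * s ^ (k - 1) := by
        rw [← abs_of_pos hs0, ← abs_mul, abs_of_pos hs0, e1, e2]
        have b1 := abs_sub_abs_le_abs_add ((∑ i with γ i = k, p i) * (k * s ^ k))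
          (∑ i with ¬ γ i = k, p i * ((γ i : ℝ) * s ^ γ i))
        have b2 : ε * s ^ k ≤ |(∑ i with γ i = k, p i) * (k * s ^ k)| := by
          rw [abs_mul, abs_of_nonneg (by positivity : (0 : ℝ) ≤ k * s ^ k)]
          have : s ^ k ≤ k * s ^ k := le_mul_of_one_le_left (by positivity) hk1
          gcongr
        linarith
      have e5 : D ≤ ε / 2 * s := by
        rw [div_le_iff₀ hε] at hs2; linarith
      have e6 : D * s ^ (k - 1) ≤ ε / 2 * s * s ^ (k - 1) := by gcongr
      refine le_of_mul_le_mul_left ?_ hs0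
      rw [hpw] at e4
      linarith
    · have e1 : (∑ i, p i * ((γ i : ℝ) * (((γ i - 1 : ℕ) : ℝ) * s ^ (γ i - 1 - 1)))) * s =
          ∑ i, p i * ((γ i : ℝ) * (((γ i - 1 : ℕ) : ℝ) * s ^ (γ i - 1))) := by
        rw [Finset.sum_mul]
        refine Finset.sum_congr rfl fun i _ => ?_
        rcases Nat.eq_zero_or_pos (γ i - 1) with h | h
        · rw [h]; simp
        · have : s ^ (γ i - 1) = s ^ (γ i - 1 - 1) * s := by rw [← pow_succ]; congr 1; lia
          rw [this]; ring
      rw [← abs_of_pos hs0, ← abs_mul, abs_of_pos hs0, e1]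
      calc _ ≤ ∑ i, |p i * ((γ i : ℝ) * (((γ i - 1 : ℕ) : ℝ) * s ^ (γ i - 1)))| :=
            Finset.abs_sum_le_sum_abs _ _
        _ ≤ ∑ i : Fin n, (M * k ^ 2 * s ^ (k - 1)) := by
          refine Finset.sum_le_sum fun i _ => ?_
          rcases le_or_gt (γ i) k with h | h
          · rw [abs_mul, abs_of_nonneg (by positivity :
              (0 : ℝ) ≤ (γ i : ℝ) * (((γ i - 1 : ℕ) : ℝ) * s ^ (γ i - 1))), mul_assoc, sq, mul_assoc]
            have a1 : (γ i : ℝ) ≤ (k : ℝ) := by exact_mod_cast h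
            have a3 : ((γ i - 1 : ℕ) : ℝ) ≤ (k : ℝ) := by exact_mod_cast (by lia)
            have a2 : s ^ (γ i - 1) ≤ s ^ (k - 1) := pow_le_pow_right₀ hs1 (by lia)
            have := hpM i
            gcongr
          · rw [hpk i h]; simp; positivity
        _ = D * s ^ (k - 1) := by simp [hD]; ring
  have hfin := osc_bound_s11 (fun t => ∑ i, p i * t ^ γ i)
    (fun s => ∑ i, p i * ((γ i : ℝ) * s ^ (γ i - 1)))
    (fun s => ∑ i, p i * ((γ i : ℝ) * (((γ i - 1 : ℕ) : ℝ) * s ^ (γ i - 1 - 1))))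
    (fun t => HasDerivAt.fun_sum fun i _ => (hasDerivAt_pow (γ i) t).const_mul (p i))
    (fun t => HasDerivAt.fun_sum fun i _ =>
      ((hasDerivAt_pow (γ i - 1) t).const_mul (γ i : ℝ)).const_mul (p i))
    (by fun_prop) A B (ε / 2) δ hAB (by positivity)
    (by
      intro s hs
      obtain ⟨h1, -, h3, -⟩ := hmain s hs
      have : 1 ≤ s ^ (k - 1) := one_le_pow₀ h3
      refine le_trans ?_ h1
      exact le_mul_of_one_le_right (by positivity) this)
    (by
      intro s hs
      obtain ⟨h1, h2, h3, h4⟩ := hmain s hs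
      have hs0 : 0 < s := by linarith
      set X := |∑ i, p i * ((γ i : ℝ) * s ^ (γ i - 1))| with hX
      have hw : 1 ≤ s ^ (k - 1) := one_le_pow₀ h3
      set w := s ^ (k - 1) with hwdef
      rw [← sq_abs, ← hX]
      refine le_of_mul_le_mul_right ?_ hs0
      refine h2.trans ?_
      have q1 : (ε / 2 * w) ^ 2 ≤ X ^ 2 := by gcongr
      have q2 : 4 * D ≤ s * (ε ^ 2 * δ) := by rwa [div_le_iff₀ (by positivity)] at h4
      have q3 : D * w ≤ s * (ε ^ 2 * δ) / 4 * w := by gcongr; linarith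
      have q4 : s * (ε ^ 2 * δ) / 4 * w ≤ s * (ε ^ 2 * δ) / 4 * w ^ 2 := by
        gcongr; nlinarith
      calc D * w ≤ δ * (ε / 2 * w) ^ 2 * s := by nlinarith
        _ ≤ δ * X ^ 2 * s := by gcongr)
  refine hfin.trans (le_of_eq ?_)
  field_simp
  ring

lemma osc_final {n : ℕ} (γ : Fin n → ℕ) (hγ : ∀ i, 0 < γ i) (k : ℕ) (hk : 0 < k) (ε M : ℝ)
    (hε : 0 < ε) (hM : 0 ≤ M) (T₀ η : ℝ) (hη : 0 < η) :
    ∃ T₁ : ℝ, ∀ T ≥ T₁, ∀ p : Fin n → ℝ, (∀ i, |p i| ≤ M) → (∀ i, k < γ i → p i = 0) →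
      ε ≤ |∑ i with γ i = k, p i| →
      ‖∫ t in (0 : ℝ)..T, Complex.exp (Complex.I * ((∑ i, p i * (T₀ + t) ^ γ i : ℝ) : ℂ))‖ ≤
        η * T := by
  obtain ⟨S, hS⟩ := osc_poly γ hγ k hk ε M hε hM (η / 2) (by positivity)
  set A := max S T₀ with hA
  have hAT : T₀ ≤ A := le_max_right _ _
  refine ⟨max (A - T₀) (2 * (A - T₀ + 4 / ε) / η), ?_⟩
  intro T hT p h1 h2 h3
  have hT1 : A - T₀ ≤ T := (le_max_left _ _).trans hT
  have hT2 : 2 * (A - T₀ + 4 / ε) / η ≤ T := (le_max_right _ _).trans hT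
  have hc : Continuous fun t : ℝ => Complex.exp (Complex.I * ((∑ i, p i * t ^ γ i : ℝ) : ℂ)) := by
    fun_prop
  have hshift := intervalIntegral.integral_comp_add_left (a := 0) (b := T)
    (fun t : ℝ => Complex.exp (Complex.I * ((∑ i, p i * t ^ γ i : ℝ) : ℂ))) T₀
  simp only [add_zero] at hshift
  rw [hshift, ← intervalIntegral.integral_add_adjacent_intervals
    (hc.intervalIntegrable T₀ A) (hc.intervalIntegrable A (T₀ + T))]
  have b1 := hS p h1 h2 h3 A (T₀ + T) (le_max_left _ _) (by linarith)
  have b2 := intervalIntegral.norm_integral_le_of_norm_le_const (a := T₀) (b := A) (C := 1)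
    (f := fun t : ℝ => Complex.exp (Complex.I * ((∑ i, p i * t ^ γ i : ℝ) : ℂ)))
    (fun t _ => by rw [mul_comm, Complex.norm_exp_ofReal_mul_I])
  rw [abs_of_nonneg (by linarith), one_mul] at b2
  refine (norm_add_le _ _).trans ?_
  rw [div_le_iff₀ hη] at hT2
  nlinarith [mul_nonneg hη.le (sub_nonneg.2 hAT)]

theorem stmt11 {m : ℕ} (U : Set (Fin m → ℝ)) (hUopen : IsOpen U) (hUconn : IsConnected U)
    (a : (Fin m → ℝ) → ℝ) (ha : ContinuousOn a U)
    {J : Type} [Fintype J] [Nonempty J]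
    (f : J → (Fin m → ℝ) → ℂ) (hf : ∀ j, AnalyticOnNhd ℝ (f j) U)
    (hfne : ∀ j, ∃ x ∈ U, f j x ≠ 0)
    (d : ℕ) (hd : 1 ≤ d)
    (φc : J → ℕ → (Fin m → ℝ) → ℝ) (hφc : ∀ j k, AnalyticOnNhd ℝ (φc j k) U)
    (φ : J → (Fin m → ℝ) → ℝ → ℝ)
    (hφdef : ∀ j x t, φ j x t = ∑ k ∈ Finset.Icc 1 d, φc j k x * t ^ k)
    (hφdist : ∀ j j' : J, j ≠ j' → ∃ x ∈ U, ∃ t : ℝ, φ j x t ≠ φ j' x t)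
    (hφne : ∃ j, ∃ x ∈ U, ∃ t : ℝ, φ j x t ≠ 0) :
    ∃ n : ℕ, 1 ≤ n ∧
    ∃ c : Fin n → (Fin m → ℝ) → ℝ, (∀ i, AnalyticOnNhd ℝ (c i) U) ∧
    ∃ γ : Fin n → ℕ, (∀ i, 0 < γ i) ∧
    ∃ α : J → Fin n → ℤ, Function.Injective α ∧
    ∃ B : Set (Fin m → ℝ), B ⊆ U ∧ MeasurableSet B ∧ volume (U \ B) = 0 ∧
      -- (i) f(x,t) = F(x, ψ(x,t)) on A
      (∀ x ∈ U, ∀ t : ℝ, a x < t →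
        ∑ j, f j x * Complex.exp (Complex.I * (φ j x t : ℝ)) =
          ∑ j, f j x * Complex.exp (2 * (Real.pi : ℂ) * Complex.I *
            ((∑ i, (α j i : ℝ) * (c i x * t ^ γ i) : ℝ) : ℂ))) ∧
      -- (ii) for x ∈ B, z ↦ F(x,z) is nonconstant
      (∀ x ∈ B, ∃ z z' : Fin n → ℝ,
        (∑ j, f j x * Complex.exp (2 * (Real.pi : ℂ) * Complex.I *
            ((∑ i, (α j i : ℝ) * z i : ℝ) : ℂ))) ≠
        (∑ j, f j x * Complex.exp (2 * (Real.pi : ℂ) * Complex.I *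
            ((∑ i, (α j i : ℝ) * z' i : ℝ) : ℂ)))) ∧
      -- (iii) c.u.d. mod 1 on large compact subsets
      (∀ Ω : Set (Fin m → ℝ), Ω ⊆ U → IsOpen Ω → ∀ lam : ℝ,
        ENNReal.ofReal lam < volume Ω →
          ∃ K : Set (Fin m → ℝ), IsCompact K ∧ K ⊆ Ω ∩ B ∧
            ENNReal.ofReal lam ≤ volume K ∧
            ∃ T₀ : ℝ, (∀ x ∈ K, a x < T₀) ∧
              IsCudModOneOn (fun (x : K) (t : ℝ) (i : Fin n) =>
                c i x.val * (T₀ + t) ^ γ i)) := by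
  classical
  have hpi : (2 * Real.pi) ≠ 0 := by positivity
  obtain ⟨n, c, hc, γ, hγ, α, hα, hind⟩ := basis_all U d (fun j k x => φc j k x / (2 * Real.pi))
    (fun j k x hx => (hφc j k x hx).div analyticAt_const hpi)
  have hφα : ∀ j, ∀ x ∈ U, ∀ t : ℝ,
      φ j x t = 2 * Real.pi * ∑ i, (α j i : ℝ) * (c i x * t ^ γ i) := by
    intro j x hx t
    rw [← hα j x hx t, hφdef, Finset.mul_sum]
    refine Finset.sum_congr rfl fun k _ => ?_
    field_simp
  obtain ⟨j₀, x₀, hx₀, t₀, hne₀⟩ := hφne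
  have hαj₀ : α j₀ ≠ 0 := by
    intro h
    apply hne₀
    rw [hφα j₀ x₀ hx₀, h]
    simp
  have hinj : Function.Injective α := by
    intro j j' h
    by_contra hjj
    obtain ⟨x, hx, t, ht⟩ := hφdist j j' hjj
    apply ht
    rw [hφα j x hx, hφα j' x hx, h]
  have hn : 1 ≤ n := by
    rcases Nat.eq_zero_or_pos n with h | h
    · subst h
      exact absurd (Subsingleton.elim (α j₀) 0) hαj₀
    · exact h
  -- leading degree
  have hdeg : ∀ v : {v : Fin n → ℤ // v ≠ 0}, ∃ k, (∃ i, γ i = k ∧ v.1 i ≠ 0) ∧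
      ∀ i, k < γ i → v.1 i = 0 := by
    rintro ⟨v, hv⟩
    obtain ⟨i, hi⟩ := Function.ne_iff.1 hv
    obtain ⟨i₁, hi₁, hmax⟩ := Finset.exists_max_image (Finset.univ.filter fun i => v i ≠ 0) γ
      ⟨i, by simpa using hi⟩
    refine ⟨γ i₁, ⟨i₁, rfl, (Finset.mem_filter.1 hi₁).2⟩, fun l hl => ?_⟩
    by_contra hne
    have := hmax l (by simpa using hne)
    lia
  choose kk hkk hkk' using hdeg
  let lead : {v : Fin n → ℤ // v ≠ 0} → (Fin m → ℝ) → ℝ := fun v x =>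
    ∑ i with γ i = kk v, (v.1 i : ℝ) * c i x
  have hleadA : ∀ v, AnalyticOnNhd ℝ (lead v) U := fun v x hx =>
    Finset.analyticAt_fun_sum _ (fun i _ => analyticAt_const.mul (hc i x hx))
  have hopenF : IsOpen (U ∩ (f j₀) ⁻¹' {0}ᶜ) :=
    (hf j₀).continuousOn.isOpen_inter_preimage hUopen isOpen_compl_singleton
  have hopenL : ∀ v, IsOpen (U ∩ (lead v) ⁻¹' {0}ᶜ) := fun v =>
    (hleadA v).continuousOn.isOpen_inter_preimage hUopen isOpen_compl_singleton
  let B : Set (Fin m → ℝ) := (U ∩ (f j₀) ⁻¹' {0}ᶜ) ∩ ⋂ v, (U ∩ (lead v) ⁻¹' {0}ᶜ)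
  have hBU : B ⊆ U := fun x hx => hx.1.1
  have hBm : MeasurableSet B :=
    hopenF.measurableSet.inter (MeasurableSet.iInter fun v => (hopenL v).measurableSet)
  have hnullF : volume {x | x ∈ U ∧ f j₀ x = 0} = 0 := by
    obtain ⟨x, hx, hfx⟩ := hfne j₀
    by_cases hre : (f j₀ x).re = 0
    · have him : (f j₀ x).im ≠ 0 := fun h => hfx (Complex.ext hre h)
      refine measure_mono_null ?_ (analytic_zero_null U hUopen hUconn (fun x => (f j₀ x).im)
        (fun y hy => (Complex.imCLM.analyticAt _).comp (hf j₀ y hy)) ⟨x, hx, him⟩)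
      rintro y ⟨hy, hy0⟩
      exact ⟨hy, by simp [hy0]⟩
    · refine measure_mono_null ?_ (analytic_zero_null U hUopen hUconn (fun x => (f j₀ x).re)
        (fun y hy => (Complex.reCLM.analyticAt _).comp (hf j₀ y hy)) ⟨x, hx, hre⟩)
      rintro y ⟨hy, hy0⟩
      exact ⟨hy, by simp [hy0]⟩
  have hnullL : ∀ v, volume {x | x ∈ U ∧ lead v x = 0} = 0 := fun v =>
    analytic_zero_null U hUopen hUconn _ (hleadA v) (hind v.1 (kk v) (hkk v))
  have hnull : volume (U \ B) = 0 := by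
    refine measure_mono_null (t := {x | x ∈ U ∧ f j₀ x = 0} ∪ ⋃ v, {x | x ∈ U ∧ lead v x = 0}) ?_ 
      (measure_union_null hnullF (measure_iUnion_null hnullL))
    rintro x ⟨hxU, hxB⟩
    by_contra hcon
    apply hxB
    simp only [mem_union, mem_iUnion, not_or, not_exists] at hcon
    refine ⟨⟨hxU, fun h => hcon.1 ⟨hxU, h⟩⟩, mem_iInter.2 fun v => ⟨hxU, fun h => hcon.2 v ⟨hxU, h⟩⟩⟩
  refine ⟨n, hn, c, hc, γ, hγ, α, hinj, B, hBU, hBm, hnull, ?_, ?_, ?_⟩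
  · intro x hx t _
    refine Finset.sum_congr rfl fun j _ => ?_
    rw [hφα j x hx t]
    congr 2
    push_cast
    ring
  · intro x hx
    exact nonconst α hinj (fun j => f j x) j₀ hαj₀ hx.1.2
  · intro Ω hΩU hΩo lam hlam
    have hvol : volume (Ω ∩ B) = volume Ω := by
      have h1 := measure_inter_add_sdiff (μ := volume) Ω hBm
      rw [measure_mono_null (sdiff_subset_sdiff_left hΩU) hnull, add_zero] at h1
      exact h1
    rw [← hvol] at hlam
    obtain ⟨K, hKsub, hKc, hKv⟩ :=
      (hΩo.measurableSet.inter hBm).exists_lt_isCompact hlam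
    have hKU : K ⊆ U := fun x hx => hBU (hKsub hx).2
    obtain ⟨C₀, hC₀⟩ := (hKc.image_of_continuousOn (ha.mono hKU)).bddAbove
    refine ⟨K, hKc, hKsub, hKv.le, C₀ + 1, ?_, ?_⟩
    · intro x hx
      have := hC₀ (mem_image_of_mem a hx)
      linarith
    · apply weyl_s11
      · intro x
        fun_prop
      · intro β hβ η hη
        have hM : ∃ M, 0 ≤ M ∧ ∀ x ∈ K, ∀ i, |2 * Real.pi * ((β i : ℝ) * c i x)| ≤ M := by
          have : ∀ i, ∃ M, 0 ≤ M ∧ ∀ x ∈ K, |2 * Real.pi * ((β i : ℝ) * c i x)| ≤ M := by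
            intro i
            obtain ⟨M, hM⟩ := hKc.exists_bound_of_continuousOn
              (f := fun x => 2 * Real.pi * ((β i : ℝ) * c i x))
              (continuousOn_const.mul (continuousOn_const.mul ((hc i).continuousOn.mono hKU)))
            exact ⟨max M 0, le_max_right _ _, fun x hx => (hM x hx).trans (le_max_left _ _)⟩
          choose M hM0 hM using this
          refine ⟨∑ i, M i, Finset.sum_nonneg fun i _ => hM0 i, fun x hx i => (hM i x hx).trans ?_⟩
          exact Finset.single_le_sum (fun i _ => hM0 i) (Finset.mem_univ i)
        obtain ⟨M, hM0, hM⟩ := hM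
        have hε : ∃ ε > 0, ∀ x ∈ K, ε ≤ |2 * Real.pi * lead ⟨β, hβ⟩ x| := by
          rcases K.eq_empty_or_nonempty with h | h
          · exact ⟨1, one_pos, by simp [h]⟩
          · obtain ⟨x, hx, hmin⟩ := hKc.exists_isMinOn h
              (f := fun x => |2 * Real.pi * lead ⟨β, hβ⟩ x|)
              ((continuousOn_const.mul ((hleadA ⟨β, hβ⟩).continuousOn.mono hKU)).abs)
            refine ⟨_, ?_, fun y hy => hmin hy⟩
            have : lead ⟨β, hβ⟩ x ≠ 0 := (mem_iInter.1 (hKsub hx).2.2 ⟨β, hβ⟩).2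
            positivity
        obtain ⟨ε, hε0, hε⟩ := hε
        have hkpos : 0 < kk ⟨β, hβ⟩ := by
          obtain ⟨i, hi, -⟩ := hkk ⟨β, hβ⟩
          rw [← hi]; exact hγ i
        obtain ⟨T₁, hT₁⟩ := osc_final γ hγ (kk ⟨β, hβ⟩) hkpos ε M hε0 hM0 (C₀ + 1) η hη
        refine ⟨T₁, fun T hT x => ?_⟩
        have key := hT₁ T hT (fun i => 2 * Real.pi * ((β i : ℝ) * c i x)) (hM x x.2)
          (fun i hi => by
            have : β i = 0 := hkk' ⟨β, hβ⟩ i hi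
            simp [this])
          (by rw [← Finset.mul_sum]; exact hε x x.2)
        refine le_trans (le_of_eq ?_) key
        congr 2
        funext t
        congr 1
        have : (∑ i, 2 * Real.pi * ((β i : ℝ) * c i x) * (C₀ + 1 + t) ^ γ i) =
            2 * Real.pi * ∑ i, (β i : ℝ) * (c i x * (C₀ + 1 + t) ^ γ i) := by
          rw [Finset.mul_sum]
          refine Finset.sum_congr rfl fun i _ => by ring
        rw [this]
        push_cast
        ring
end
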